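/- arXiv:1202.1029 — 4 statements merged into one kernel-verified Lean document; each statement's English description precedes it below -/
import Mathlib

section
/- For all integers p, q, r with min{p+q, p−q} ≥ 0, one has 1/π = ((1/2)_{p+q−r} · (1/2)_{p−q−r} / (1/2)_r) · ∑_{k=0}^∞ [(1/2)_{k+2p} (1/2)_{k+2q} (1/2)_{k−2q} (1/2)_{k+r}] / [k! · (k+p+q)! · (k+p−q)! · (1/2)_{k+2p−2r}] · (6k+4p+1)/4^{k+r+1}. -/
/-- The shifted factorial `(x)ₙ = Γ(x + n) / Γ(x)` for a real `x` and an
integer `n` (possibly negative). For a nonnegative integer `n` this equals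
`x (x+1) ⋯ (x+n-1)`. -/
noncomputable def shiftedFactorial (x : ℝ) (n : ℤ) : ℝ :=
  Real.Gamma (x + n) / Real.Gamma x


open Filter Topology

theorem half_add_intCast_ne_zero (n : ℤ) : (1 / 2 + n : ℝ) ≠ 0 := by
  intro h
  have h2 : (1 + 2 * n : ℝ) = 0 := by linarith
  have h3 : (1 + 2 * n : ℤ) = 0 := by exact_mod_cast h2
  omega

theorem Gamma_half_add_intCast_ne_zero (n : ℤ) : Real.Gamma (1 / 2 + n) ≠ 0 := by
  refine Real.Gamma_ne_zero fun m h => half_add_intCast_ne_zero (n + m) ?_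
  push_cast
  linarith

theorem shiftedFactorial_half_ne_zero (n : ℤ) : shiftedFactorial (1 / 2) n ≠ 0 :=
  div_ne_zero (Gamma_half_add_intCast_ne_zero n)
    (by simpa using Gamma_half_add_intCast_ne_zero 0)

theorem shiftedFactorial_half_add_one (n : ℤ) :
    shiftedFactorial (1 / 2) (n + 1) = (n + 1 / 2) * shiftedFactorial (1 / 2) n := by
  have h := Real.Gamma_add_one (half_add_intCast_ne_zero n)
  unfold shiftedFactorial
  push_cast
  rw [← add_assoc, h]
  ring

theorem shiftedFactorial_half_zero : shiftedFactorial (1 / 2) 0 = 1 := by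
  have h := Gamma_half_add_intCast_ne_zero 0
  unfold shiftedFactorial
  simp only [Int.cast_zero, add_zero] at h ⊢
  exact div_self h

/-- A consequence of the reflection formula. -/
theorem shiftedFactorial_half_mul_neg_of_even (q : ℤ) :
    shiftedFactorial (1 / 2) (2 * q) * shiftedFactorial (1 / 2) (-(2 * q)) = 1 := by
  have h := Real.Gamma_mul_Gamma_one_sub (1 / 2 + 2 * q)
  have hs : Real.sin (Real.pi * (1 / 2 + 2 * q)) = 1 := by
    rw [show Real.pi * (1 / 2 + 2 * q) = Real.pi / 2 + q * (2 * Real.pi) by ring,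
      Real.sin_add_int_mul_two_pi, Real.sin_pi_div_two]
  rw [hs, div_one] at h
  unfold shiftedFactorial
  rw [div_mul_div_comm, Real.Gamma_one_half_eq, Real.mul_self_sqrt Real.pi_pos.le]
  push_cast
  rw [show (1 / 2 + -(2 * q) : ℝ) = 1 - (1 / 2 + 2 * q) by ring, h]
  exact div_self Real.pi_ne_zero

theorem factorial_toNat_add_one {n : ℤ} (hn : 0 ≤ n) :
    ((n + 1).toNat.factorial : ℝ) = (n + 1) * (n.toNat.factorial : ℝ) := by
  lift n to ℕ using hn
  rw [show ((n : ℤ) + 1).toNat = n + 1 by omega, Nat.factorial_succ]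
  push_cast
  simp

/-- The summand of the series, including the prefactor. -/
noncomputable def ramanujanTerm (p q r : ℤ) (k : ℕ) : ℝ :=
  (shiftedFactorial (1/2) (p + q - r) * shiftedFactorial (1/2) (p - q - r) /
    shiftedFactorial (1/2) r) *
  ((shiftedFactorial (1/2) ((k : ℤ) + 2*p) * shiftedFactorial (1/2) ((k : ℤ) + 2*q) *
      shiftedFactorial (1/2) ((k : ℤ) - 2*q) * shiftedFactorial (1/2) ((k : ℤ) + r)) /
    ((k.factorial : ℝ) * (((k : ℤ) + p + q).toNat.factorial : ℝ) *
      (((k : ℤ) + p - q).toNat.factorial : ℝ) *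
      shiftedFactorial (1/2) ((k : ℤ) + 2*p - 2*r)) *
    ((6*(k : ℝ) + 4*(p : ℝ) + 1) / (4 : ℝ) ^ ((k : ℤ) + r + 1)))

/-- The ratio of consecutive summands. -/
noncomputable def ramanujanRatio (p q r : ℤ) (k : ℕ) : ℝ :=
  (k + 2 * p + 1 / 2) * (k + 2 * q + 1 / 2) * (k - 2 * q + 1 / 2) * (k + r + 1 / 2) /
    ((k + 1) * (k + p + q + 1) * (k + p - q + 1) * (k + 2 * p - 2 * r + 1 / 2)) *
    ((6 * k + 4 * p + 7) / (6 * k + 4 * p + 1) / 4)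

theorem linear_factor_pos {p q : ℤ} (h1 : 0 ≤ p + q) (h2 : 0 ≤ p - q) (k : ℕ) :
    (0 : ℝ) < 6 * k + 4 * p + 1 := by
  have : (0 : ℤ) < 6 * k + 4 * p + 1 := by omega
  exact_mod_cast this

theorem ramanujanTerm_ne_zero {p q : ℤ} (r : ℤ) (h1 : 0 ≤ p + q) (h2 : 0 ≤ p - q) (k : ℕ) :
    ramanujanTerm p q r k ≠ 0 := by
  have := (linear_factor_pos h1 h2 k).ne'
  have h4 : (4 : ℝ) ^ ((k : ℤ) + r + 1) ≠ 0 := by positivity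
  simp [ramanujanTerm, -one_div, shiftedFactorial_half_ne_zero, Nat.factorial_ne_zero, this, h4]

theorem ramanujanTerm_succ {p q : ℤ} (r : ℤ) (h1 : 0 ≤ p + q) (h2 : 0 ≤ p - q) (k : ℕ) :
    ramanujanTerm p q r (k + 1) = ramanujanTerm p q r k * ramanujanRatio p q r k := by
  have hl := (linear_factor_pos h1 h2 k).ne'
  have e1 := shiftedFactorial_half_add_one (k + 2 * p)
  have e2 := shiftedFactorial_half_add_one (k + 2 * q)
  have e3 := shiftedFactorial_half_add_one (k - 2 * q)
  have e4 := shiftedFactorial_half_add_one (k + r)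
  have e5 := shiftedFactorial_half_add_one (k + 2 * p - 2 * r)
  have e6 := factorial_toNat_add_one (n := k + p + q) (by omega)
  have e7 := factorial_toNat_add_one (n := k + p - q) (by omega)
  have e8 : (4 : ℝ) ^ ((k : ℤ) + r + 1 + 1) = 4 ^ ((k : ℤ) + r + 1) * 4 :=
    zpow_add_one₀ (by norm_num) _
  unfold ramanujanTerm ramanujanRatio
  rw [Nat.factorial_succ,
    show ((k + 1 : ℕ) : ℤ) + 2 * p = k + 2 * p + 1 by push_cast; ring,
    show ((k + 1 : ℕ) : ℤ) + 2 * q = k + 2 * q + 1 by push_cast; ring,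
    show ((k + 1 : ℕ) : ℤ) - 2 * q = k - 2 * q + 1 by push_cast; ring,
    show ((k + 1 : ℕ) : ℤ) + r + 1 = k + r + 1 + 1 by push_cast; ring,
    show ((k + 1 : ℕ) : ℤ) + r = k + r + 1 by push_cast; ring,
    show (k : ℤ) + 2 * p + 1 - 2 * r = k + 2 * p - 2 * r + 1 by ring,
    show ((k + 1 : ℕ) : ℤ) + p + q = k + p + q + 1 by push_cast; ring,
    show ((k + 1 : ℕ) : ℤ) + p - q = k + p - q + 1 by push_cast; ring,
    e1, e2, e3, e4, e5, e6, e7, e8]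
  push_cast
  rw [show (6 * ((k : ℝ) + 1) + 4 * p + 1) = 6 * k + 4 * p + 7 by ring]
  obtain ⟨y, hy⟩ : ∃ y, 6 * (k : ℝ) + 4 * p + 7 = (6 * k + 4 * p + 1) * y :=
    ⟨_, (mul_div_cancel₀ _ hl).symm⟩
  rw [hy, mul_div_cancel_left₀ y hl]
  simp only [div_eq_mul_inv, mul_inv]
  ring

theorem ramanujanTerm_add_one {p q : ℤ} (r : ℤ) (h1 : 0 ≤ p + q) (h2 : 0 ≤ p - q) (k : ℕ) :
    ramanujanTerm (p + 1) q r k = ramanujanTerm p q r k *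
      ((p + q - r + 1 / 2) * (p - q - r + 1 / 2) *
        ((k + 2 * p + 1 / 2) * (k + 2 * p + 3 / 2)) /
        ((k + p + q + 1) * (k + p - q + 1) *
          ((k + 2 * p - 2 * r + 1 / 2) * (k + 2 * p - 2 * r + 3 / 2))) *
        ((6 * k + 4 * p + 5) / (6 * k + 4 * p + 1))) := by
  have hl := (linear_factor_pos h1 h2 k).ne'
  have e1 := shiftedFactorial_half_add_one (k + 2 * p)
  have e1' := shiftedFactorial_half_add_one (k + 2 * p + 1)
  have e2 := shiftedFactorial_half_add_one (p + q - r)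
  have e3 := shiftedFactorial_half_add_one (p - q - r)
  have e5 := shiftedFactorial_half_add_one (k + 2 * p - 2 * r)
  have e5' := shiftedFactorial_half_add_one (k + 2 * p - 2 * r + 1)
  have e6 := factorial_toNat_add_one (n := k + p + q) (by omega)
  have e7 := factorial_toNat_add_one (n := k + p - q) (by omega)
  unfold ramanujanTerm
  rw [show (k : ℤ) + 2 * (p + 1) = k + 2 * p + 1 + 1 by ring,
    show p + 1 + q - r = p + q - r + 1 by ring,
    show p + 1 - q - r = p - q - r + 1 by ring,
    show (k : ℤ) + 2 * p + 1 + 1 - 2 * r = k + 2 * p - 2 * r + 1 + 1 by ring,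
    show (k : ℤ) + (p + 1) + q = k + p + q + 1 by ring,
    show (k : ℤ) + (p + 1) - q = k + p - q + 1 by ring,
    e1', e5', e1, e2, e3, e5, e6, e7]
  push_cast
  rw [show (6 * (k : ℝ) + 4 * (p + 1) + 1) = 6 * k + 4 * p + 5 by ring,
    show (k + 2 * p + 1 + 1 / 2 : ℝ) = k + 2 * p + 3 / 2 by ring,
    show (k + 2 * p - 2 * r + 1 + 1 / 2 : ℝ) = k + 2 * p - 2 * r + 3 / 2 by ring]
  obtain ⟨y, hy⟩ : ∃ y, 6 * (k : ℝ) + 4 * p + 5 = (6 * k + 4 * p + 1) * y :=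
    ⟨_, (mul_div_cancel₀ _ hl).symm⟩
  rw [hy, mul_div_cancel_left₀ y hl]
  simp only [div_eq_mul_inv, mul_inv]
  ring

/-- The Wilf–Zeilberger certificate of the summand for the shift `p ↦ p + 1`. -/
noncomputable def ramanujanCertificate (p r : ℤ) (k : ℕ) : ℝ :=
  8 * k * (k + 2 * p + 1 / 2 - r) / ((6 * k + 4 * p + 1) * (k + 2 * p - 2 * r + 1 / 2))

theorem ramanujanTerm_wilf_zeilberger {p q : ℤ} (r : ℤ) (h1 : 0 ≤ p + q) (h2 : 0 ≤ p - q)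
    (k : ℕ) :
    ramanujanTerm (p + 1) q r k - ramanujanTerm p q r k =
      ramanujanCertificate p r (k + 1) * ramanujanTerm p q r (k + 1) -
        ramanujanCertificate p r k * ramanujanTerm p q r k := by
  rw [ramanujanTerm_succ r h1 h2, ramanujanTerm_add_one r h1 h2]
  unfold ramanujanCertificate ramanujanRatio
  have hl := (linear_factor_pos h1 h2 k).ne'
  have hl' : (6 * (k : ℝ) + 4 * p + 7) ≠ 0 :=
    (by linarith [linear_factor_pos h1 h2 k] : (0 : ℝ) < 6 * k + 4 * p + 7).ne'
  have ha : (k + 2 * p - 2 * r + 1 / 2 : ℝ) ≠ 0 := by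
    have := half_add_intCast_ne_zero (k + 2 * p - 2 * r)
    push_cast at this
    rwa [add_comm]
  have hb : (k + 2 * p - 2 * r + 1 / 2 + 1 : ℝ) ≠ 0 := by
    have := half_add_intCast_ne_zero (k + 2 * p - 2 * r + 1)
    push_cast at this
    contrapose! this
    linarith
  have hc : (k + p + q + 1 : ℝ) ≠ 0 := by
    have : (k + p + q + 1 : ℤ) ≠ 0 := by omega
    exact_mod_cast this
  have hd : (k + p - q + 1 : ℝ) ≠ 0 := by
    have : (k + p - q + 1 : ℤ) ≠ 0 := by omega
    exact_mod_cast this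
  have hk : (k + 1 : ℝ) ≠ 0 := by positivity
  push_cast
  rw [show (6 * ((k : ℝ) + 1) + 4 * p + 1) = 6 * k + 4 * p + 7 by ring,
    show (k + 1 + 2 * p - 2 * r + 1 / 2 : ℝ) = k + 2 * p - 2 * r + 1 / 2 + 1 by ring,
    show (k + 2 * p - 2 * r + 3 / 2 : ℝ) = k + 2 * p - 2 * r + 1 / 2 + 1 by ring]
  generalize ramanujanTerm p q r k = T
  generalize hx : (k + 2 * p - 2 * r + 1 / 2 : ℝ) = x at *
  generalize hy : (6 * k + 4 * p + 1 : ℝ) = y at *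
  generalize hz : (6 * k + 4 * p + 7 : ℝ) = z at *
  generalize hu : (k + p + q + 1 : ℝ) = u at *
  generalize hv : (k + p - q + 1 : ℝ) = v at *
  generalize hw : (k + 1 : ℝ) = w at *
  field_simp
  subst hx hy hz hu hv hw
  ring

/-- Variant of `tendsto_add_mul_div_add_mul_atTop_nhds` with a simplified slope. -/
theorem tendsto_linear_div_linear (a b c : ℝ) {d : ℝ} (hd : d ≠ 0) :
    Tendsto (fun n : ℕ => (c * n + a) / (d * n + b)) atTop (𝓝 (c / d)) := by
  simpa only [add_comm] using tendsto_add_mul_div_add_mul_atTop_nhds a b c hd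

theorem tendsto_ramanujanRatio (p q r : ℤ) :
    Tendsto (ramanujanRatio p q r) atTop (𝓝 (1 / 4)) := by
  have h := ((((tendsto_linear_div_linear (2 * p + 1 / 2) 1 1 one_ne_zero).mul
    (tendsto_linear_div_linear (2 * q + 1 / 2) (p + q + 1) 1 one_ne_zero)).mul
    (tendsto_linear_div_linear (-2 * q + 1 / 2) (p - q + 1) 1 one_ne_zero)).mul
    (tendsto_linear_div_linear (r + 1 / 2) (2 * p - 2 * r + 1 / 2) 1 one_ne_zero)).mul
    ((tendsto_linear_div_linear (4 * p + 7) (4 * p + 1) 6 (by norm_num : (6 : ℝ) ≠ 0)).mul_const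
      (1 / 4))
  convert h using 1
  · ext k
    unfold ramanujanRatio
    simp only [div_eq_mul_inv, mul_inv]
    ring
  · norm_num

theorem tendsto_ramanujanCertificate (p r : ℤ) :
    Tendsto (ramanujanCertificate p r) atTop (𝓝 (4 / 3)) := by
  have h := (tendsto_linear_div_linear 0 (4 * p + 1) 8 (by norm_num : (6 : ℝ) ≠ 0)).mul
    (tendsto_linear_div_linear (2 * p + 1 / 2 - r) (2 * p - 2 * r + 1 / 2) 1 one_ne_zero)
  convert h using 1
  · ext k
    unfold ramanujanCertificate
    simp only [div_eq_mul_inv, mul_inv]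
    ring
  · norm_num

theorem summable_ramanujanTerm {p q : ℤ} (r : ℤ) (h1 : 0 ≤ p + q) (h2 : 0 ≤ p - q) :
    Summable (ramanujanTerm p q r) := by
  refine summable_of_ratio_test_tendsto_lt_one (l := 1 / 4) (by norm_num)
    (Eventually.of_forall (ramanujanTerm_ne_zero r h1 h2)) ?_
  have h := (tendsto_ramanujanRatio p q r).norm
  rw [show ‖(1 / 4 : ℝ)‖ = 1 / 4 by norm_num] at h
  refine h.congr fun k => ?_
  rw [ramanujanTerm_succ r h1 h2, norm_mul,
    mul_div_cancel_left₀ _ (norm_ne_zero_iff.mpr (ramanujanTerm_ne_zero r h1 h2 k))]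

theorem tsum_ramanujanTerm_add_one {p q : ℤ} (r : ℤ) (h1 : 0 ≤ p + q) (h2 : 0 ≤ p - q) :
    ∑' k, ramanujanTerm (p + 1) q r k = ∑' k, ramanujanTerm p q r k := by
  have s := summable_ramanujanTerm r h1 h2
  have s' := summable_ramanujanTerm (p := p + 1) (q := q) r (by omega) (by omega)
  have hlim := (s'.sub s).hasSum.tendsto_sum_nat
  have hG := (tendsto_ramanujanCertificate p r).mul s.tendsto_atTop_zero
  rw [mul_zero] at hG
  have h0 : ∑' k, (ramanujanTerm (p + 1) q r k - ramanujanTerm p q r k) = 0 := by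
    refine tendsto_nhds_unique hlim (hG.congr fun n => ?_)
    simp only [ramanujanTerm_wilf_zeilberger r h1 h2]
    rw [Finset.sum_range_sub fun k => ramanujanCertificate p r k * ramanujanTerm p q r k]
    simp [ramanujanCertificate]
  rw [s'.tsum_sub s] at h0
  exact sub_eq_zero.mp h0

theorem tsum_ramanujanTerm_add_nat {p q : ℤ} (r : ℤ) (h1 : 0 ≤ p + q) (h2 : 0 ≤ p - q) (n : ℕ) :
    ∑' k, ramanujanTerm (p + n) q r k = ∑' k, ramanujanTerm p q r k := by
  induction n with
  | zero => simp
  | succ n ih =>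
    rw [show p + ((n + 1 : ℕ) : ℤ) = p + n + 1 by push_cast; ring,
      tsum_ramanujanTerm_add_one r (by omega) (by omega), ih]

theorem abs_ramanujanRatio_le {p q r : ℤ} (hp : 5 + 4 * |r| + 5 * q ^ 2 * (1 + |r|) ≤ p) (k : ℕ) :
    |ramanujanRatio p q r k| ≤ 1 / 2 := by
  have hR : (0 : ℝ) ≤ |(r : ℝ)| := abs_nonneg _
  have hp' : 5 + 4 * |(r : ℝ)| + 5 * (q : ℝ) ^ 2 * (1 + |(r : ℝ)|) ≤ p := by exact_mod_cast hp
  have hk : (0 : ℝ) ≤ k := k.cast_nonneg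
  have hr := le_abs_self (r : ℝ)
  have hq2 : 0 ≤ (q : ℝ) ^ 2 := sq_nonneg _
  have hqR : 0 ≤ (q : ℝ) ^ 2 * |(r : ℝ)| := by positivity
  have hp5 : (5 : ℝ) ≤ p := by nlinarith
  have hp4 : 4 * |(r : ℝ)| ≤ p := by nlinarith
  have e : ramanujanRatio p q r k = (k + 2 * p + 1 / 2) / (k + 2 * p - 2 * r + 1 / 2) *
      ((k + 2 * q + 1 / 2) * (k - 2 * q + 1 / 2) * (k + r + 1 / 2) /
        ((k + 1) * ((k + p + q + 1) * (k + p - q + 1)))) *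
      ((6 * k + 4 * p + 7) / (6 * k + 4 * p + 1)) / 4 := by
    unfold ramanujanRatio
    simp only [div_eq_mul_inv, mul_inv]
    ring
  have b1 : |(k + 2 * p + 1 / 2) / (k + 2 * p - 2 * r + 1 / 2 : ℝ)| ≤ 4 / 3 := by
    have hd : (0 : ℝ) < k + 2 * p - 2 * r + 1 / 2 := by linarith
    rw [abs_of_nonneg (div_nonneg (by linarith) hd.le), div_le_iff₀ hd]
    linarith
  have b3 : |(6 * k + 4 * p + 7) / (6 * k + 4 * p + 1 : ℝ)| ≤ 4 / 3 := by
    have hd : (0 : ℝ) < 6 * k + 4 * p + 1 := by linarith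
    rw [abs_of_nonneg (div_nonneg (by linarith) hd.le), div_le_iff₀ hd]
    linarith
  have b2 : |(k + 2 * q + 1 / 2) * (k - 2 * q + 1 / 2) * (k + r + 1 / 2) /
      ((k + 1) * ((k + p + q + 1) * (k + p - q + 1)) : ℝ)| ≤ 1 := by
    have hpp : 5 * (q : ℝ) ^ 2 * (1 + |(r : ℝ)|) ≤ p ^ 2 := by nlinarith
    have hd : 0 < (k + p + q + 1 : ℝ) * (k + p - q + 1) := by nlinarith
    have n1 : |(k + 2 * q + 1 / 2 : ℝ) * (k - 2 * q + 1 / 2)| ≤ (k + 1) ^ 2 + 4 * q ^ 2 := by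
      rw [abs_le]
      constructor <;> nlinarith
    have n2 : |(k + r + 1 / 2 : ℝ)| ≤ k + 1 + |(r : ℝ)| := by
      rw [abs_le]
      constructor <;> linarith [neg_abs_le (r : ℝ)]
    rw [abs_div, abs_mul, abs_of_pos (by positivity : 0 < (k + 1 : ℝ) * _), div_le_one (by positivity)]
    refine (mul_le_mul n1 n2 (abs_nonneg _) (by positivity)).trans ?_
    have t1 : 0 ≤ (k + 1 : ℝ) ^ 2 * (2 * p - |(r : ℝ)|) :=
      mul_nonneg (by positivity) (by linarith)
    have t2 : 0 ≤ (k + 1 : ℝ) * (p ^ 2 - 5 * (q : ℝ) ^ 2 * (1 + |(r : ℝ)|)) :=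
      mul_nonneg (by positivity) (by linarith)
    nlinarith [mul_nonneg hk hqR]
  rw [e, abs_div, abs_mul, abs_mul]
  calc _ ≤ 4 / 3 * 1 * (4 / 3) / |(4 : ℝ)| := by gcongr
    _ ≤ 1 / 2 := by norm_num

theorem tendsto_ramanujanRatio_zero (q r : ℤ) :
    Tendsto (fun n : ℕ => ramanujanRatio n q r 0) atTop (𝓝 0) := by
  have h := (((tendsto_linear_div_linear (1 / 2) (-2 * r + 1 / 2) 2 (two_ne_zero (α := ℝ))).mul
    (tendsto_linear_div_linear ((2 * q + 1 / 2) * (-2 * q + 1 / 2)) (q + 1) 0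
      (one_ne_zero (α := ℝ)))).mul
    (tendsto_linear_div_linear (r + 1 / 2) (-q + 1) 0 (one_ne_zero (α := ℝ)))).mul
    ((tendsto_linear_div_linear 7 1 4 (four_ne_zero (α := ℝ))).mul_const (1 / 4))
  convert h using 1
  · ext n
    unfold ramanujanRatio
    simp only [div_eq_mul_inv, mul_inv]
    push_cast
    ring
  · norm_num

theorem abs_tsum_sub_le_of_abs_succ_le {f : ℕ → ℝ} (hf : ∀ k, |f (k + 1)| ≤ 1 / 2 * |f k|) :
    |∑' k, f k - f 0| ≤ 2 * |f 1| := by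
  have hs : Summable f := summable_of_ratio_norm_eventually_le (f := f) (r := 1 / 2) (by norm_num)
    (Eventually.of_forall hf)
  have hb : ∀ k, ‖f (k + 1)‖ ≤ |f 1| * (1 / 2) ^ k := by
    intro k
    rw [Real.norm_eq_abs]
    induction k with
    | zero => simp
    | succ k ih =>
      refine (hf (k + 1)).trans ?_
      rw [pow_succ]
      linarith
  rw [hs.tsum_eq_zero_add, add_sub_cancel_left, mul_comm, ← Real.norm_eq_abs]
  exact tsum_of_norm_bounded (hasSum_geometric_two.mul_left |f 1|) hb

/-- Shifting the argument of a function with `f (n + 1) = (n + c) f n` by an integer `m`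
multiplies it asymptotically by `n ^ m`. -/
theorem tendsto_shift_div_of_recurrence {f : ℤ → ℝ} {c : ℝ} (hf0 : ∀ n, f n ≠ 0)
    (hf : ∀ n : ℤ, 0 ≤ n → f (n + 1) = (n + c) * f n) (m : ℤ) :
    Tendsto (fun n : ℕ => f (n + m) / (f n * (n : ℝ) ^ m)) atTop (𝓝 1) := by
  have step : ∀ m : ℤ, ∀ᶠ n : ℕ in atTop,
      f (n + (m + 1)) / (f n * (n : ℝ) ^ (m + 1)) =
        f (n + m) / (f n * (n : ℝ) ^ m) * ((1 * n + (m + c)) / (1 * n + 0)) := by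
    intro m
    filter_upwards [eventually_ge_atTop (1 + m.natAbs)] with n hn
    have hn0 : (n : ℝ) ≠ 0 := by
      have : n ≠ 0 := by omega
      exact_mod_cast this
    rw [← add_assoc, hf _ (by omega), zpow_add_one₀ hn0, div_mul_div_comm]
    push_cast
    ring_nf
  have lim : ∀ m : ℤ, Tendsto (fun n : ℕ => (1 * n + (m + c)) / (1 * n + 0)) atTop (𝓝 1) :=
    fun m => by simpa using tendsto_linear_div_linear (m + c) 0 1 (one_ne_zero (α := ℝ))
  induction m using Int.induction_on with
  | zero => simp [hf0]
  | succ m ih => simpa using (ih.mul (lim m)).congr' ((step m).mono fun n h => h.symm)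
  | pred m ih =>
    have l := lim (-m - 1)
    have key := ih.div l one_ne_zero
    rw [div_one] at key
    refine key.congr' ?_
    filter_upwards [step (-m - 1), l.eventually_ne one_ne_zero] with n hn hne
    rw [sub_add_cancel] at hn
    rw [Pi.div_apply, hn, mul_div_cancel_right₀ _ hne]

theorem tendsto_shiftedFactorial_half_shift (m : ℤ) :
    Tendsto (fun n : ℕ => shiftedFactorial (1 / 2) (n + m) /
      (shiftedFactorial (1 / 2) n * (n : ℝ) ^ m)) atTop (𝓝 1) :=
  tendsto_shift_div_of_recurrence shiftedFactorial_half_ne_zero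
    (fun n _ => shiftedFactorial_half_add_one n) m

theorem tendsto_factorial_shift (m : ℤ) :
    Tendsto (fun n : ℕ => (((n : ℤ) + m).toNat.factorial : ℝ) /
      (n.factorial * (n : ℝ) ^ m)) atTop (𝓝 1) := by
  simpa only [Int.toNat_natCast] using
    tendsto_shift_div_of_recurrence (f := fun n => (n.toNat.factorial : ℝ))
      (fun n => by positivity) (fun n hn => factorial_toNat_add_one hn) m

theorem prod_range_half_add (n : ℕ) :
    ∏ j ∈ Finset.range n, (1 / 2 + j : ℝ) = shiftedFactorial (1 / 2) n := by
  induction n with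
  | zero => simpa using shiftedFactorial_half_zero.symm
  | succ n ih =>
    rw [Finset.prod_range_succ, ih, Nat.cast_succ, shiftedFactorial_half_add_one]
    push_cast
    ring

/-- A form of the Wallis product. -/
theorem tendsto_shiftedFactorial_half_sq :
    Tendsto (fun n : ℕ => (shiftedFactorial (1 / 2) n) ^ 2 / (n.factorial : ℝ) ^ 2 *
      ((4 * n + 1) / 4)) atTop (𝓝 (1 / Real.pi)) := by
  have h := ((Real.GammaSeq_tendsto_Gamma (1 / 2)).pow 2).inv₀
    (by rw [Real.Gamma_one_half_eq]; positivity)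
  rw [Real.Gamma_one_half_eq, Real.sq_sqrt Real.pi_pos.le] at h
  have h' := (h.mul (tendsto_linear_div_linear 0 (1 / 2) 1 (one_ne_zero (α := ℝ)))).mul
    ((tendsto_linear_div_linear 1 2 4 (four_ne_zero (α := ℝ))))
  rw [div_self one_ne_zero, div_self four_ne_zero, mul_one, mul_one, ← one_div] at h'
  refine h'.congr' ?_
  filter_upwards [eventually_gt_atTop 0] with n hn
  have hn0 : (0 : ℝ) < n := by exact_mod_cast hn
  have hg := shiftedFactorial_half_ne_zero n
  rw [Real.GammaSeq, prod_range_half_add, Nat.cast_succ, shiftedFactorial_half_add_one,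
    ← Real.sqrt_eq_rpow, div_pow, mul_pow, Real.sq_sqrt hn0.le]
  push_cast
  field_simp
  ring

theorem tendsto_ramanujanTerm_zero (q r : ℤ) :
    Tendsto (fun n : ℕ => ramanujanTerm n q r 0) atTop (𝓝 (1 / Real.pi)) := by
  have two_mul_lim : Tendsto (fun n : ℕ => 2 * n) atTop atTop :=
    tendsto_id.const_mul_atTop' two_pos
  have h := (((tendsto_shiftedFactorial_half_shift (q - r)).mul
    (tendsto_shiftedFactorial_half_shift (-q - r))).div
    (((tendsto_factorial_shift q).mul (tendsto_factorial_shift (-q))).mul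
      ((tendsto_shiftedFactorial_half_shift (-2 * r)).comp two_mul_lim)) (by norm_num)).mul
    tendsto_shiftedFactorial_half_sq
  simp only [one_mul, mul_one, div_one] at h
  refine h.congr' ?_
  filter_upwards [eventually_gt_atTop 0] with n hn
  have hn0 : (n : ℝ) ≠ 0 := by exact_mod_cast hn.ne'
  have hq := shiftedFactorial_half_mul_neg_of_even q
  rw [mul_comm] at hq
  have hr := shiftedFactorial_half_ne_zero r
  have hg := shiftedFactorial_half_ne_zero n
  have hg2 := shiftedFactorial_half_ne_zero (2 * n)
  have z1 : (n : ℝ) ^ (-q - r) * (n : ℝ) ^ (q - r) = ((n : ℝ) ^ r * (n : ℝ) ^ r)⁻¹ := by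
    rw [← zpow_add₀ hn0, ← zpow_add₀ hn0, ← zpow_neg]
    ring_nf
  have z2 : (n : ℝ) ^ (-q) * (n : ℝ) ^ q = 1 := by
    rw [← zpow_add₀ hn0, neg_add_cancel, zpow_zero]
  have z3 : (2 * n : ℝ) ^ (-2 * r) = ((4 : ℝ) ^ r * ((n : ℝ) ^ r * (n : ℝ) ^ r))⁻¹ := by
    rw [neg_mul, zpow_neg, zpow_mul, ← mul_zpow, ← mul_zpow]
    congr 2
    rw [zpow_ofNat]
    ring
  have z4 : (4 : ℝ) ^ (((0 : ℕ) : ℤ) + r + 1) = 4 ^ r * 4 := by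
    rw [Nat.cast_zero, zero_add, zpow_add_one₀ four_ne_zero]
  have hq0 := shiftedFactorial_half_ne_zero (2 * q)
  have hz : ∀ m : ℤ, (n : ℝ) ^ m ≠ 0 := fun m => zpow_ne_zero m hn0
  have h4 : (4 : ℝ) ^ r ≠ 0 := zpow_ne_zero r four_ne_zero
  have hg3 := shiftedFactorial_half_ne_zero (2 * n - 2 * r)
  simp only [ramanujanTerm, Pi.div_apply, Function.comp_apply, z4]
  push_cast
  rw [z3, eq_div_of_mul_eq (hz _) z1, eq_div_of_mul_eq (hz _) z2,
    zero_sub, eq_div_of_mul_eq hq0 hq]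
  simp only [zero_add, mul_zero, Nat.factorial_zero, Nat.cast_one]
  rw [show (n : ℤ) + (q - r) = n + q - r by ring, show (n : ℤ) + (-q - r) = n - q - r by ring,
    show (2 * n : ℤ) + -2 * r = 2 * n - 2 * r by ring, ← sub_eq_add_neg]
  field_simp

theorem tendsto_tsum_ramanujanTerm (q r : ℤ) :
    Tendsto (fun n : ℕ => ∑' k, ramanujanTerm n q r k) atTop (𝓝 (1 / Real.pi)) := by
  have h0 := tendsto_ramanujanTerm_zero q r
  have htail : Tendsto (fun n : ℕ => 2 * |ramanujanTerm n q r 0 * ramanujanRatio n q r 0|)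
      atTop (𝓝 0) := by
    simpa using (h0.mul (tendsto_ramanujanRatio_zero q r)).abs.const_mul 2
  have hsub : Tendsto (fun n : ℕ => ∑' k, ramanujanTerm n q r k - ramanujanTerm n q r 0)
      atTop (𝓝 0) := by
    refine squeeze_zero_norm' ?_ htail
    filter_upwards [eventually_ge_atTop (5 + 4 * |r| + 5 * q ^ 2 * (1 + |r|)).toNat,
      eventually_ge_atTop q.natAbs] with n hn hnq
    have h1 : 0 ≤ (n : ℤ) + q := by omega
    have h2 : 0 ≤ (n : ℤ) - q := by omega
    rw [Real.norm_eq_abs, ← ramanujanTerm_succ r h1 h2]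
    refine abs_tsum_sub_le_of_abs_succ_le fun k => ?_
    rw [ramanujanTerm_succ r h1 h2, abs_mul, mul_comm]
    exact mul_le_mul_of_nonneg_right (abs_ramanujanRatio_le (Int.toNat_le.mp hn) k) (abs_nonneg _)
  simpa using hsub.add h0

theorem tsum_ramanujanTerm {p q : ℤ} (r : ℤ) (h1 : 0 ≤ p + q) (h2 : 0 ≤ p - q) :
    ∑' k, ramanujanTerm p q r k = 1 / Real.pi := by
  refine tendsto_nhds_unique (tendsto_const_nhds.congr' ?_) (tendsto_tsum_ramanujanTerm q r)
  filter_upwards [eventually_ge_atTop p.toNat] with n hn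
  rw [← tsum_ramanujanTerm_add_nat r h1 h2 (n - p.toNat)]
  congr! 3
  omega

theorem extension_of_ramanujan_first (p q r : ℤ)
    (h : 0 ≤ min (p + q) (p - q)) :
    1 / Real.pi =
      (shiftedFactorial (1/2) (p + q - r) * shiftedFactorial (1/2) (p - q - r) /
        shiftedFactorial (1/2) r) *
      ∑' k : ℕ,
        (shiftedFactorial (1/2) ((k : ℤ) + 2*p) * shiftedFactorial (1/2) ((k : ℤ) + 2*q) *
          shiftedFactorial (1/2) ((k : ℤ) - 2*q) * shiftedFactorial (1/2) ((k : ℤ) + r)) /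
        ((k.factorial : ℝ) * (((k : ℤ) + p + q).toNat.factorial : ℝ) *
          (((k : ℤ) + p - q).toNat.factorial : ℝ) *
          shiftedFactorial (1/2) ((k : ℤ) + 2*p - 2*r)) *
        ((6*(k : ℝ) + 4*(p : ℝ) + 1) / (4 : ℝ) ^ ((k : ℤ) + r + 1)) := by
  obtain ⟨h1, h2⟩ := le_min_iff.mp h
  rw [← tsum_mul_left]
  exact (tsum_ramanujanTerm r h1 h2).symm
end

section
/- For all integers p, q with min{p+q, p−q} ≥ 0, one has 2·(−1)^q/(3^{3q−1/2}·π) = (1/2)_{p+2q} · ∑_{k=0}^∞ [(1/2)_{k+3p} (1/2)_{k+3q} (1/2)_{2k−3q}] / [k! · (k+p−q)! · (2k+3p+3q)!] · (8k+6p+1)/9^k. -/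
open Filter Topology

namespace GesselStanton

/-- The `k`-th term of the normalised Gessel–Stanton series of argument `1/9`. -/
noncomputable def term (a b : ℝ) (k : ℕ) : ℝ :=
  Real.Gamma (b + k) * Real.Gamma (1 - b + 2 * k) * Real.Gamma (a + k) * (a + 4 * k) *
      Real.Gamma ((a + 2 * b) / 3) /
    (k.factorial * Real.Gamma (1 + k + (a - b) / 3) * Real.Gamma (a + b + 2 * k) * 9 ^ k)

/-- The quotient of two consecutive terms of the series. -/
noncomputable def ratio (a b : ℝ) (k : ℕ) : ℝ :=
  (a + k) / (1 + (a - b) / 3 + k) * ((b + k) / (1 + k)) *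
    ((1 - b + 2 * k) / (a + b + 2 * k)) * ((2 - b + 2 * k) / (a + b + 1 + 2 * k)) *
    ((a + 4 + 4 * k) / (a + 4 * k)) / 9

/-- The rational certificate of the Wilf–Zeilberger pair. -/
noncomputable def cert (a b : ℝ) (k : ℕ) : ℝ :=
  k / (a + 4 * k) * ((6 * a + 3 * b + 9 * k) / (a + b + 2 * k))

theorem term_succ {a b : ℝ} (ha : 0 < a) (hd : 0 < a - b + 3) (hs : 0 < a + b)
    (hb : ∀ n : ℤ, b ≠ n) (k : ℕ) : term a b (k + 1) = ratio a b k * term a b k := by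
  have hk : (0 : ℝ) ≤ k := k.cast_nonneg
  have h1 : b + k ≠ 0 := fun h => hb (-k) (by push_cast; linarith)
  have h2 : 1 - b + 2 * k ≠ 0 := fun h => hb (1 + 2 * k) (by push_cast; linarith)
  have h3 : 1 - b + 2 * k + 1 ≠ 0 := fun h => hb (2 + 2 * k) (by push_cast; linarith)
  have h4 : a + k ≠ 0 := by positivity
  have h5 : 0 < 1 + k + (a - b) / 3 := by linarith
  have h6 : 0 < a + b + 2 * k := by positivity
  have e1 : Real.Gamma (b + (k + 1 : ℕ)) = (b + k) * Real.Gamma (b + k) := by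
    rw [← Real.Gamma_add_one h1]; push_cast; ring_nf
  have e2 : Real.Gamma (1 - b + 2 * (k + 1 : ℕ)) =
      (1 - b + 2 * k + 1) * ((1 - b + 2 * k) * Real.Gamma (1 - b + 2 * k)) := by
    rw [← Real.Gamma_add_one h2, ← Real.Gamma_add_one h3]; push_cast; ring_nf
  have e3 : Real.Gamma (a + (k + 1 : ℕ)) = (a + k) * Real.Gamma (a + k) := by
    rw [← Real.Gamma_add_one h4]; push_cast; ring_nf
  have e4 : Real.Gamma (1 + (k + 1 : ℕ) + (a - b) / 3) =
      (1 + k + (a - b) / 3) * Real.Gamma (1 + k + (a - b) / 3) := by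
    rw [← Real.Gamma_add_one h5.ne']; push_cast; ring_nf
  have e5 : Real.Gamma (a + b + 2 * (k + 1 : ℕ)) =
      (a + b + 2 * k + 1) * ((a + b + 2 * k) * Real.Gamma (a + b + 2 * k)) := by
    rw [← Real.Gamma_add_one h6.ne', ← Real.Gamma_add_one (by positivity)]; push_cast; ring_nf
  have g4 := (Real.Gamma_pos_of_pos h5).ne'
  have g5 := (Real.Gamma_pos_of_pos h6).ne'
  have h7 : 0 < a + 4 * k := by positivity
  have h8 : 0 < a + b + 1 + 2 * k := by positivity
  have h9 : 0 < 1 + (a - b) / 3 + k := by linarith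
  have h10 : (k.factorial : ℝ) ≠ 0 := by positivity
  rw [term, term, ratio, e1, e2, e3, e4, e5, Nat.factorial_succ, Nat.cast_mul, Nat.cast_succ]
  generalize Real.Gamma (b + k) = x1
  generalize Real.Gamma (1 - b + 2 * k) = x2
  generalize Real.Gamma (a + k) = x3
  generalize Real.Gamma ((a + 2 * b) / 3) = x4
  generalize Real.Gamma (1 + k + (a - b) / 3) = x5 at *
  generalize Real.Gamma (a + b + 2 * k) = x6 at *
  generalize (k.factorial : ℝ) = x7 at *
  rw [show a + b + 2 * (k : ℝ) + 1 = a + b + 1 + 2 * k by ring,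
    show 1 + (k : ℝ) + (a - b) / 3 = 1 + (a - b) / 3 + k by ring]
  generalize hw : 1 + (a - b) / 3 + (k : ℝ) = w at *
  field_simp
  ring

theorem term_add_three {a b : ℝ} (ha : 0 < a) (hd : 0 < a - b + 3) (hs : 0 < a + b)
    (hc : a + 2 * b ≠ 0) (k : ℕ) :
    term (a + 3) b k = (a + k) * (a + k + 1) * (a + k + 2) * (a + 3 + 4 * k) *
        ((a + 2 * b) / 3) /
      ((1 + k + (a - b) / 3) * (a + b + 2 * k) * (a + b + 2 * k + 1) * (a + b + 2 * k + 2) *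
        (a + 4 * k)) * term a b k := by
  have h4 : 0 < a + k := by positivity
  have h5 : 0 < 1 + k + (a - b) / 3 := by linarith [(k.cast_nonneg : (0 : ℝ) ≤ k)]
  have h6 : 0 < a + b + 2 * k := by positivity
  have h7 : 0 < a + 4 * k := by positivity
  have e3 : Real.Gamma (a + 3 + k) =
      (a + k + 2) * ((a + k + 1) * ((a + k) * Real.Gamma (a + k))) := by
    rw [← Real.Gamma_add_one h4.ne', ← Real.Gamma_add_one (by positivity),
      show a + k + 2 = a + k + 1 + 1 by ring, ← Real.Gamma_add_one (by positivity)]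
    ring_nf
  have e4 : Real.Gamma (1 + k + (a + 3 - b) / 3) =
      (1 + k + (a - b) / 3) * Real.Gamma (1 + k + (a - b) / 3) := by
    rw [← Real.Gamma_add_one h5.ne']; ring_nf
  have e5 : Real.Gamma (a + 3 + b + 2 * k) = (a + b + 2 * k + 2) *
      ((a + b + 2 * k + 1) * ((a + b + 2 * k) * Real.Gamma (a + b + 2 * k))) := by
    rw [← Real.Gamma_add_one h6.ne', ← Real.Gamma_add_one (by positivity),
      show a + b + 2 * k + 2 = a + b + 2 * k + 1 + 1 by ring,
      ← Real.Gamma_add_one (by positivity)]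
    ring_nf
  have e6 : Real.Gamma ((a + 3 + 2 * b) / 3) =
      ((a + 2 * b) / 3) * Real.Gamma ((a + 2 * b) / 3) := by
    rw [← Real.Gamma_add_one (div_ne_zero hc three_ne_zero)]; ring_nf
  have g4 := (Real.Gamma_pos_of_pos h5).ne'
  have g5 := (Real.Gamma_pos_of_pos h6).ne'
  have h10 : (k.factorial : ℝ) ≠ 0 := by positivity
  rw [term, term, e3, e4, e5, e6]
  generalize Real.Gamma (b + k) = x1
  generalize Real.Gamma (1 - b + 2 * k) = x2
  generalize Real.Gamma (a + k) = x3
  generalize Real.Gamma ((a + 2 * b) / 3) = x4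
  generalize Real.Gamma (1 + k + (a - b) / 3) = x5 at *
  generalize Real.Gamma (a + b + 2 * k) = x6 at *
  generalize (k.factorial : ℝ) = x7 at *
  generalize hw : 1 + k + (a - b) / 3 = w at *
  field_simp

/-- The Wilf–Zeilberger relation between the series at `a + 3` and at `a`. -/
theorem term_add_three_sub {a b : ℝ} (ha : 0 < a) (hd : 0 < a - b + 3) (hs : 0 < a + b)
    (hb : ∀ n : ℤ, b ≠ n) (hc : a + 2 * b ≠ 0) (k : ℕ) :
    term (a + 3) b k - term a b k =
      cert a b (k + 1) * term a b (k + 1) - cert a b k * term a b k := by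
  have h5 : 0 < 3 + 3 * k + a - b := by linarith [(k.cast_nonneg : (0 : ℝ) ≤ k)]
  have h6 : 0 < a + b + 2 * k := by positivity
  have h7 : 0 < a + 4 * k := by positivity
  have h8 : 0 < a + 4 * (k + 1) := by positivity
  have h9 : 0 < a + b + 2 * (k + 1) := by positivity
  have h10 : 0 < a + b + 1 + 2 * k := by positivity
  rw [term_add_three ha hd hs hc, term_succ ha hd hs hb, ratio, cert, cert,
    show a + b + 2 * (k : ℝ) + 1 = a + b + 1 + 2 * k by ring,
    show a + b + 2 * (k : ℝ) + 2 = a + b + 2 * (k + 1) by ring,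
    show 1 + (a - b) / 3 + (k : ℝ) = (3 + 3 * k + a - b) / 3 by ring,
    show 1 + (k : ℝ) + (a - b) / 3 = (3 + 3 * k + a - b) / 3 by ring,
    show a + 4 + 4 * (k : ℝ) = a + 4 * (k + 1) by ring]
  rw [← sub_eq_zero]
  push_cast
  generalize term a b k = t
  generalize hw : 3 + 3 * (k : ℝ) + a - b = w at *
  field_simp
  rw [← hw]
  ring

theorem tendsto_ratio (a b : ℝ) : Tendsto (ratio a b) atTop (𝓝 (1 / 9)) := by
  have h := (((((tendsto_add_mul_div_add_mul_atTop_nhds a (1 + (a - b) / 3) 1 one_ne_zero).mul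
    (tendsto_add_mul_div_add_mul_atTop_nhds b 1 1 one_ne_zero)).mul
    (tendsto_add_mul_div_add_mul_atTop_nhds (1 - b) (a + b) 2 two_ne_zero)).mul
    (tendsto_add_mul_div_add_mul_atTop_nhds (2 - b) (a + b + 1) 2 two_ne_zero)).mul
    (tendsto_add_mul_div_add_mul_atTop_nhds (a + 4) a 4 four_ne_zero)).div_const 9
  simp only [one_mul] at h
  convert h using 2
  · rfl
  · norm_num

theorem tendsto_cert (a b : ℝ) : Tendsto (cert a b) atTop (𝓝 (9 / 8)) := by
  have h := (tendsto_add_mul_div_add_mul_atTop_nhds 0 a 1 four_ne_zero).mul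
    (tendsto_add_mul_div_add_mul_atTop_nhds (6 * a + 3 * b) (a + b) 9 two_ne_zero)
  simp only [one_mul, zero_add] at h
  convert h using 2
  · rfl
  · norm_num

theorem term_ne_zero {a b : ℝ} (ha : 0 < a) (hd : 0 < a - b + 3) (hs : 0 < a + b)
    (hb : ∀ n : ℤ, b ≠ n) (hc : ∀ n : ℕ, (a + 2 * b) / 3 ≠ -n) (k : ℕ) : term a b k ≠ 0 := by
  have hk : (0 : ℝ) ≤ k := k.cast_nonneg
  have g1 : Real.Gamma (b + k) ≠ 0 := Real.Gamma_ne_zero fun m h =>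
    hb (-k - m) (by push_cast; linarith)
  have g2 : Real.Gamma (1 - b + 2 * k) ≠ 0 := Real.Gamma_ne_zero fun m h =>
    hb (1 + 2 * k + m) (by push_cast; linarith)
  have g3 := (Real.Gamma_pos_of_pos (show 0 < a + k by positivity)).ne'
  have g4 := Real.Gamma_ne_zero hc
  have g5 := (Real.Gamma_pos_of_pos (show 0 < 1 + k + (a - b) / 3 by linarith)).ne'
  have g6 := (Real.Gamma_pos_of_pos (show 0 < a + b + 2 * k by positivity)).ne'
  rw [term]
  positivity

theorem summable_term {a b : ℝ} (ha : 0 < a) (hd : 0 < a - b + 3) (hs : 0 < a + b)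
    (hb : ∀ n : ℤ, b ≠ n) (hc : ∀ n : ℕ, (a + 2 * b) / 3 ≠ -n) : Summable (term a b) := by
  have hne := term_ne_zero ha hd hs hb hc
  refine summable_of_ratio_test_tendsto_lt_one (l := ‖(1 / 9 : ℝ)‖) (by norm_num)
    (.of_forall hne) ((tendsto_ratio a b).norm.congr fun k => ?_)
  rw [term_succ ha hd hs hb, norm_mul, mul_div_cancel_right₀ _ (norm_ne_zero_iff.2 (hne k))]

theorem add_three_mul_ne {a b : ℝ} (hc : ∀ n : ℕ, (a + 2 * b) / 3 ≠ -n) (m n : ℕ) :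
    (a + 3 * m + 2 * b) / 3 ≠ -n := fun h => hc (n + m) (by push_cast; linarith)

theorem tsum_term_add_three {a b : ℝ} (ha : 0 < a) (hd : 0 < a - b + 3) (hs : 0 < a + b)
    (hb : ∀ n : ℤ, b ≠ n) (hc : ∀ n : ℕ, (a + 2 * b) / 3 ≠ -n) :
    ∑' k, term (a + 3) b k = ∑' k, term a b k := by
  have s0 := summable_term ha hd hs hb hc
  have s3 : Summable (term (a + 3) b) := summable_term (by linarith) (by linarith)
    (by linarith) hb (by simpa using add_three_mul_ne hc 1)
  have hc0 : a + 2 * b ≠ 0 := fun h => hc 0 (by simp [h])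
  have hlim := (s3.sub s0).hasSum.tendsto_sum_nat
  simp only [term_add_three_sub ha hd hs hb hc0,
    Finset.sum_range_sub (fun k => cert a b k * term a b k)] at hlim
  have hz := ((tendsto_cert a b).mul s0.tendsto_atTop_zero).sub_const
    (cert a b 0 * term a b 0)
  have h0 := tendsto_nhds_unique hlim hz
  simp only [← term_add_three_sub ha hd hs hb hc0] at h0
  rw [s3.tsum_sub s0] at h0
  simp only [cert, CharP.cast_eq_zero, zero_div, zero_mul, mul_zero, sub_zero] at h0
  exact sub_eq_zero.1 h0

theorem tsum_term_add_three_mul {a b : ℝ} (ha : 0 < a) (hd : 0 < a - b + 3) (hs : 0 < a + b)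
    (hb : ∀ n : ℤ, b ≠ n) (hc : ∀ n : ℕ, (a + 2 * b) / 3 ≠ -n) (m : ℕ) :
    ∑' k, term (a + 3 * m) b k = ∑' k, term a b k := by
  induction m with
  | zero => simp
  | succ m ih =>
    have hm : (0 : ℝ) ≤ m := m.cast_nonneg
    rw [← ih, ← tsum_term_add_three (a := a + 3 * m) (by linarith) (by linarith) (by linarith) hb
      (add_three_mul_ne hc m)]
    push_cast
    ring_nf

theorem Gamma_add_nat_add_one {s : ℝ} (hs : ∀ n : ℕ, s ≠ -n) (n : ℕ) :
    Real.Gamma (s + n + 1) = Real.Gamma s * ∏ j ∈ Finset.range (n + 1), (s + j) := by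
  induction n with
  | zero =>
    have := Real.Gamma_add_one (s := s) (by simpa using hs 0)
    simp [this, mul_comm]
  | succ n ih =>
    rw [Finset.prod_range_succ, ← mul_assoc, ← ih,
      Real.Gamma_add_one fun h => hs (n + 1) (by push_cast at h ⊢; linarith)]
    push_cast
    ring_nf

theorem tendsto_Gamma_div {s : ℝ} (hs : ∀ n : ℕ, s ≠ -n) :
    Tendsto (fun n : ℕ => Real.Gamma (s + n + 1) / ((n : ℝ) ^ s * n.factorial))
      atTop (𝓝 1) := by
  have hg := Real.Gamma_ne_zero hs
  have h := (tendsto_const_nhds (x := Real.Gamma s)).div (Real.GammaSeq_tendsto_Gamma s) hg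
  rw [div_self hg] at h
  refine h.congr fun n => ?_
  rw [Pi.div_apply, Gamma_add_nat_add_one hs, Real.GammaSeq, div_div_eq_mul_div]

theorem tendsto_Gamma_div_Gamma {s t : ℝ} (hs : ∀ n : ℕ, s ≠ -n) (ht : ∀ n : ℕ, t ≠ -n) :
    Tendsto (fun n : ℕ => Real.Gamma (s + n + 1) / Real.Gamma (t + n + 1) * (n : ℝ) ^ (t - s))
      atTop (𝓝 1) := by
  have h := (tendsto_Gamma_div hs).div (tendsto_Gamma_div ht) one_ne_zero
  rw [div_one] at h
  refine h.congr' ((eventually_gt_atTop 0).mono fun n hn => ?_)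
  have hn' : (0 : ℝ) < n := by exact_mod_cast hn
  have h1 : (0 : ℝ) < (n : ℝ) ^ s := by positivity
  have h2 : (0 : ℝ) < (n : ℝ) ^ t := by positivity
  have h3 : (n.factorial : ℝ) ≠ 0 := by positivity
  simp only [Pi.div_apply, Real.rpow_sub hn']
  field_simp

theorem tendsto_term_zero {a b : ℝ} (ha : 0 < a) (hd : 0 < a - b + 3) (hs : 0 < a + b)
    (hc : ∀ n : ℕ, (a + 2 * b) / 3 ≠ -n) :
    Tendsto (fun m : ℕ => term (a + 3 * (m + 1 : ℕ)) b 0) atTop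
      (𝓝 (Real.Gamma b * Real.Gamma (1 - b) * 3 ^ (1 - b))) := by
  have hpos : ∀ x : ℝ, 0 < x → ∀ n : ℕ, x ≠ -n := fun x hx n h => by
    linarith [(n.cast_nonneg : (0 : ℝ) ≤ n)]
  have hu : Tendsto (fun m : ℕ => 3 * m + 2) atTop atTop :=
    tendsto_atTop_mono (fun m => show m ≤ 3 * m + 2 by lia) tendsto_id
  have h1 := (tendsto_Gamma_div_Gamma (hpos a ha) (hpos (a + b) hs)).comp hu
  have h2 := tendsto_Gamma_div_Gamma hc (hpos (1 + (a - b) / 3) (by linarith))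
  have h3 := (tendsto_add_mul_div_add_mul_atTop_nhds (2 : ℝ) 0 3 one_ne_zero).rpow_const
    (p := -b) (.inl (by norm_num))
  have h4 := tendsto_add_mul_div_add_mul_atTop_nhds (a + 3) 0 3 (one_ne_zero (α := ℝ))
  have h := (((h1.mul h2).mul h3).mul h4).const_mul (Real.Gamma b * Real.Gamma (1 - b))
  have hl : (1 * 1 * (3 / 1 : ℝ) ^ (-b) * (3 / 1)) = 3 ^ (1 - b) := by
    rw [div_one, sub_eq_add_neg, Real.rpow_add (by norm_num), Real.rpow_one]; ring
  rw [hl] at h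
  refine h.congr' ((eventually_gt_atTop 0).mono fun m hm => ?_)
  have hm' : (0 : ℝ) < m := by exact_mod_cast hm
  have hn : (0 : ℝ) < 2 + 3 * m := by positivity
  have e1 : ((2 + 3 * (m : ℝ)) / (0 + 1 * m)) ^ (-b) =
      (m : ℝ) ^ b / (2 + 3 * (m : ℝ)) ^ b := by
    rw [zero_add, one_mul, Real.div_rpow hn.le hm'.le, Real.rpow_neg hn.le, Real.rpow_neg hm'.le]
    field_simp
  have e2 : (m : ℝ) ^ (1 + (a - b) / 3 - (a + 2 * b) / 3) = m / (m : ℝ) ^ b := by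
    rw [show 1 + (a - b) / 3 - (a + 2 * b) / 3 = 1 - b by ring, Real.rpow_sub hm', Real.rpow_one]
  have p1 : (0 : ℝ) < (m : ℝ) ^ b := by positivity
  have p2 : (0 : ℝ) < (2 + 3 * (m : ℝ)) ^ b := by positivity
  simp only [Function.comp_apply, term]
  push_cast
  rw [e1, e2, show a + b - a = b by ring, show 3 * (m : ℝ) + 2 = 2 + 3 * m by ring,
    show a + (2 + 3 * (m : ℝ)) + 1 = a + 3 * (m + 1) + 0 by ring,
    show a + b + (2 + 3 * (m : ℝ)) + 1 = a + 3 * (m + 1) + b + 2 * 0 by ring,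
    show (a + 2 * b) / 3 + (m : ℝ) + 1 = (a + 3 * (m + 1) + 2 * b) / 3 by ring,
    show 1 + (a - b) / 3 + (m : ℝ) + 1 = 1 + 0 + (a + 3 * (m + 1) - b) / 3 by ring,
    show a + 3 + 3 * (m : ℝ) = a + 3 * (m + 1) by ring]
  simp only [mul_zero, add_zero, pow_zero, Nat.factorial_zero, Nat.cast_one, zero_add, one_mul,
    mul_one]
  field_simp

theorem tendsto_ratio_add (a b : ℝ) (k : ℕ) :
    Tendsto (fun m : ℕ => ratio (a + 3 * (m + 1 : ℕ)) b k) atTop (𝓝 0) := by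
  have h3 : (3 : ℝ) ≠ 0 := three_ne_zero
  have h := (((((tendsto_add_mul_div_add_mul_atTop_nhds (a + 3 + k)
      (1 + (a + 3 - b) / 3 + k) 3 one_ne_zero).mul_const ((b + k) / (1 + k))).mul
    (tendsto_add_mul_div_add_mul_atTop_nhds (1 - b + 2 * k) (a + 3 + b + 2 * k) 0 h3)).mul
    (tendsto_add_mul_div_add_mul_atTop_nhds (2 - b + 2 * k) (a + 3 + b + 1 + 2 * k) 0 h3)).mul
    (tendsto_add_mul_div_add_mul_atTop_nhds (a + 3 + 4 + 4 * k) (a + 3 + 4 * k) 3 h3)).div_const 9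
  convert h using 2
  · rw [ratio]
    push_cast
    ring_nf
  · simp

theorem abs_ratio_le {a b : ℝ} (h1 : 16 ≤ a) (h2 : 4 * |b| + 2 ≤ a) (k : ℕ) :
    |ratio a b k| ≤ (|b| + k) / (1 + k) * (5 / 9) := by
  have hk : (0 : ℝ) ≤ k := k.cast_nonneg
  have b1 := le_abs_self b
  have b2 := neg_abs_le b
  have b3 := abs_nonneg b
  have f1 : |(a + k) / (1 + (a - b) / 3 + k)| ≤ 4 := by
    rw [abs_of_nonneg (div_nonneg (by linarith) (by linarith)), div_le_iff₀ (by linarith)]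
    linarith
  have f2 : |(b + k) / (1 + k)| ≤ (|b| + k) / (1 + k) := by
    rw [abs_div, abs_of_nonneg (show 0 ≤ 1 + (k : ℝ) by linarith)]
    gcongr
    simpa using abs_add_le b k
  have f3 : |(1 - b + 2 * k) / (a + b + 2 * k)| ≤ 1 := by
    rw [abs_le, le_div_iff₀ (by linarith), div_le_iff₀ (by linarith)]
    constructor <;> linarith
  have f4 : |(2 - b + 2 * k) / (a + b + 1 + 2 * k)| ≤ 1 := by
    rw [abs_le, le_div_iff₀ (by linarith), div_le_iff₀ (by linarith)]
    constructor <;> linarith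
  have f5 : |(a + 4 + 4 * k) / (a + 4 * k)| ≤ 5 / 4 := by
    rw [abs_of_nonneg (div_nonneg (by linarith) (by linarith)), div_le_iff₀ (by linarith)]
    linarith
  rw [ratio, abs_div, abs_mul, abs_mul, abs_mul, abs_mul, abs_of_pos (show (0 : ℝ) < 9 by norm_num)]
  calc _ ≤ 4 * ((|b| + k) / (1 + k)) * 1 * 1 * (5 / 4) / 9 := by gcongr
    _ = _ := by ring

/-- The summable majorant used for dominated convergence. -/
noncomputable def majorant (c : ℝ) (k : ℕ) : ℝ :=
  ∏ j ∈ Finset.range k, ((c + j) / (1 + j) * (5 / 9))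

theorem majorant_pos {c : ℝ} (hc : 0 < c) (k : ℕ) : 0 < majorant c k :=
  Finset.prod_pos fun _ _ => by positivity

theorem summable_majorant {c : ℝ} (hc : 0 < c) : Summable (majorant c) := by
  have h := (tendsto_add_mul_div_add_mul_atTop_nhds c 1 1 one_ne_zero).mul_const (5 / 9 : ℝ)
  refine summable_of_ratio_test_tendsto_lt_one (l := 1 / 1 * (5 / 9)) (by norm_num)
    (.of_forall fun k => (majorant_pos hc k).ne') (h.congr fun k => ?_)
  have hk := majorant_pos hc k
  rw [Real.norm_of_nonneg (majorant_pos hc _).le, Real.norm_of_nonneg hk.le, eq_div_iff hk.ne',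
    one_mul]
  simp only [majorant]
  rw [Finset.prod_range_succ, mul_comm]

theorem abs_term_le {a b C : ℝ} (h1 : 16 ≤ a) (h2 : 4 * |b| + 2 ≤ a) (hb : ∀ n : ℤ, b ≠ n)
    (hC : |term a b 0| ≤ C) (k : ℕ) : |term a b k| ≤ C * majorant |b| k := by
  have b1 := le_abs_self b
  have b2 := neg_abs_le b
  have hb0 : 0 < |b| := abs_pos.2 (by simpa using hb 0)
  induction k with
  | zero => simpa [majorant] using hC
  | succ k ih =>
    rw [term_succ (by linarith) (by linarith) (by linarith) hb, abs_mul]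
    calc _ ≤ (|b| + k) / (1 + k) * (5 / 9) * (C * majorant |b| k) := by
          gcongr
          exact abs_ratio_le h1 h2 k
      _ = _ := by rw [majorant, majorant, Finset.prod_range_succ]; ring

/-- The nonterminating Gessel–Stanton summation of argument `1/9`. -/
theorem tsum_term {a b : ℝ} (ha : 0 < a) (hd : 0 < a - b + 3) (hs : 0 < a + b)
    (hb : ∀ n : ℤ, b ≠ n) (hc : ∀ n : ℕ, (a + 2 * b) / 3 ≠ -n) :
    ∑' k, term a b k = Real.pi / Real.sin (Real.pi * b) * 3 ^ (1 - b) := by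
  rw [← Real.Gamma_mul_Gamma_one_sub]
  set L := Real.Gamma b * Real.Gamma (1 - b) * 3 ^ (1 - b)
  have hb0 : 0 < |b| := abs_pos.2 (by simpa using hb 0)
  have hz : Tendsto (fun m : ℕ => term (a + 3 * (m + 1 : ℕ)) b 0) atTop (𝓝 L) :=
    tendsto_term_zero ha hd hs hc
  have hpt : ∀ k, Tendsto (fun m : ℕ => term (a + 3 * (m + 1 : ℕ)) b k) atTop
      (𝓝 (if k = 0 then L else 0)) := by
    intro k
    induction k with
    | zero => simpa using hz
    | succ k ih =>
      have h := (tendsto_ratio_add a b k).mul ih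
      rw [zero_mul] at h
      simp only [Nat.add_eq_zero_iff, one_ne_zero, and_false, if_false]
      refine h.congr fun m => ?_
      have hm : (0 : ℝ) ≤ (m + 1 : ℕ) := Nat.cast_nonneg _
      rw [term_succ (by linarith) (by linarith) (by linarith) hb]
  have hA : Tendsto (fun m : ℕ => a + 3 * ((m + 1 : ℕ) : ℝ)) atTop atTop :=
    tendsto_atTop_add_const_left _ _ ((tendsto_natCast_atTop_atTop.comp
      (tendsto_add_atTop_nat 1)).const_mul_atTop three_pos)
  have hbd : ∀ᶠ m : ℕ in atTop, ∀ k, ‖term (a + 3 * (m + 1 : ℕ)) b k‖ ≤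
      (|L| + 1) * majorant |b| k := by
    filter_upwards [hA.eventually_ge_atTop 16, hA.eventually_ge_atTop (4 * |b| + 2),
      hz.abs.eventually_le_const (lt_add_one |L|)] with m h1 h2 h3
    exact abs_term_le h1 h2 hb h3
  have h := tendsto_tsum_of_dominated_convergence ((summable_majorant hb0).mul_left _) hpt hbd
  simp only [tsum_term_add_three_mul ha hd hs hb hc, tsum_ite_eq] at h
  exact tendsto_nhds_unique tendsto_const_nhds h

end GesselStanton

theorem extension_of_ramanujan_second (p q : ℤ)
    (h : 0 ≤ min (p + q) (p - q)) :
    2 * (-1 : ℝ) ^ q / ((3 : ℝ) ^ ((3*(q : ℝ)) - 1/2) * Real.pi) =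
      shiftedFactorial (1/2) (p + 2*q) *
      ∑' k : ℕ,
        (shiftedFactorial (1/2) ((k : ℤ) + 3*p) * shiftedFactorial (1/2) ((k : ℤ) + 3*q) *
          shiftedFactorial (1/2) (2*(k : ℤ) - 3*q)) /
        ((k.factorial : ℝ) * (((k : ℤ) + p - q).toNat.factorial : ℝ) *
          ((2*(k : ℤ) + 3*p + 3*q).toNat.factorial : ℝ)) *
        ((8*(k : ℝ) + 6*(p : ℝ) + 1) / (9 : ℝ) ^ k) := by
  obtain ⟨h1, h2⟩ := le_min_iff.1 h
  have r1 : (0 : ℝ) ≤ p + q := by exact_mod_cast h1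
  have r2 : (0 : ℝ) ≤ p - q := by exact_mod_cast h2
  have hb : ∀ n : ℤ, (1 / 2 + 3 * q : ℝ) ≠ n := fun n hn => by
    have : (1 + 6 * q : ℝ) = 2 * n := by linarith
    have : 1 + 6 * q = 2 * n := by exact_mod_cast this
    lia
  have hc : ∀ n : ℕ, ((1 / 2 + 3 * p : ℝ) + 2 * (1 / 2 + 3 * q)) / 3 ≠ -n := fun n hn => by
    have : (1 + 2 * p + 4 * q : ℝ) = -2 * n := by linarith
    have : 1 + 2 * p + 4 * q = -2 * n := by exact_mod_cast this
    lia
  have key := GesselStanton.tsum_term (a := 1 / 2 + 3 * p) (b := 1 / 2 + 3 * q)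
    (by linarith) (by linarith) (by linarith) hb hc
  have hpi := Real.pi_pos
  have hterm : ∀ k : ℕ, shiftedFactorial (1 / 2) (p + 2 * q) *
      ((shiftedFactorial (1/2) ((k : ℤ) + 3*p) * shiftedFactorial (1/2) ((k : ℤ) + 3*q) *
          shiftedFactorial (1/2) (2*(k : ℤ) - 3*q)) /
        ((k.factorial : ℝ) * (((k : ℤ) + p - q).toNat.factorial : ℝ) *
          ((2*(k : ℤ) + 3*p + 3*q).toNat.factorial : ℝ)) *
        ((8*(k : ℝ) + 6*(p : ℝ) + 1) / (9 : ℝ) ^ k)) =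
      2 / Real.pi ^ 2 * GesselStanton.term (1 / 2 + 3 * p) (1 / 2 + 3 * q) k := by
    intro k
    have hf : ∀ n : ℤ, 0 ≤ n → (n.toNat.factorial : ℝ) = Real.Gamma (n + 1) := by
      intro n hn
      lift n to ℕ using hn
      simp [Real.Gamma_nat_eq_factorial]
    have hp4 : Real.pi ^ 2 = √Real.pi ^ 4 := by
      rw [show √Real.pi ^ 4 = (√Real.pi ^ 2) ^ 2 by ring, Real.sq_sqrt hpi.le]
    rw [hf _ (by lia), hf _ (by lia), hp4, GesselStanton.term]
    simp only [shiftedFactorial, Real.Gamma_one_half_eq]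
    push_cast
    rw [show (1 / 2 + 3 * (q : ℝ)) + k = 1 / 2 + (k + 3 * q) by ring,
      show 1 - (1 / 2 + 3 * (q : ℝ)) + 2 * k = 1 / 2 + (2 * k - 3 * q) by ring,
      show (1 / 2 + 3 * (p : ℝ)) + k = 1 / 2 + (k + 3 * p) by ring,
      show (1 / 2 + 3 * (p : ℝ) + 2 * (1 / 2 + 3 * q)) / 3 = 1 / 2 + (p + 2 * q) by ring,
      show 1 + (k : ℝ) + (1 / 2 + 3 * (p : ℝ) - (1 / 2 + 3 * q)) / 3 = k + p - q + 1 by ring,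
      show 1 / 2 + 3 * (p : ℝ) + (1 / 2 + 3 * q) + 2 * k = 2 * k + 3 * p + 3 * q + 1 by ring]
    simp only [div_eq_mul_inv, mul_inv]
    ring
  rw [← tsum_mul_left]
  simp only [hterm]
  rw [tsum_mul_left, key]
  have hsin : Real.sin (Real.pi * (1 / 2 + 3 * q)) = (-1) ^ q := by
    rw [show Real.pi * (1 / 2 + 3 * (q : ℝ)) = ((3 * q : ℤ) : ℝ) * Real.pi + Real.pi / 2 by
        push_cast; ring,
      Real.sin_add_pi_div_two, Real.cos_int_mul_pi, zpow_mul]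
    norm_num
  have hone : (-1 : ℝ) ^ q * (-1) ^ q = 1 := by
    rw [← mul_zpow]; norm_num
  have hne : (-1 : ℝ) ^ q ≠ 0 := left_ne_zero_of_mul_eq_one hone
  have hpow : (3 : ℝ) ^ (1 - (1 / 2 + 3 * (q : ℝ))) = ((3 : ℝ) ^ (3 * (q : ℝ) - 1 / 2))⁻¹ := by
    rw [← Real.rpow_neg (by norm_num)]; ring_nf
  have h3 : (0 : ℝ) < (3 : ℝ) ^ (3 * (q : ℝ) - 1 / 2) := by positivity
  rw [hsin, hpow, div_eq_iff (by positivity)]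
  field_simp
  linear_combination hone
end

section
/- For all integers p, q with min{p+q, p−q} ≥ 0, one has 4·(−1)^q/(3^{3q+1/2}·π) = (1/2)_{p+2q+1} · ∑_{k=0}^∞ [(3/2)_{k+3p} (3/2)_{k+3q} (−1/2)_{2k−3q}] / [k! · (k+p−q)! · (2k+3p+3q+2)!] · (8k+6p+3)/9^k. -/
open Filter Topology

theorem int_add_half_ne_zero (n : ℤ) : (n : ℝ) + 1 / 2 ≠ 0 := by
  intro h
  have h2 : ((2 * n + 1 : ℤ) : ℝ) = 0 := by push_cast; linarith
  have h3 : 2 * n + 1 = 0 := by exact_mod_cast h2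
  omega

theorem shiftedFactorial_add_one {x : ℝ} {n : ℤ} (h : x + n ≠ 0) :
    shiftedFactorial x (n + 1) = (x + n) * shiftedFactorial x n := by
  unfold shiftedFactorial
  push_cast
  rw [← add_assoc, Real.Gamma_add_one h, mul_div_assoc]

theorem shiftedFactorial_one_half_add_one (n : ℤ) :
    shiftedFactorial (1 / 2) (n + 1) = (1 / 2 + n) * shiftedFactorial (1 / 2) n := by
  apply shiftedFactorial_add_one
  rw [add_comm]
  exact int_add_half_ne_zero n

theorem shiftedFactorial_three_halves_add_one (n : ℤ) :
    shiftedFactorial (3 / 2) (n + 1) = (3 / 2 + n) * shiftedFactorial (3 / 2) n := by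
  apply shiftedFactorial_add_one
  have h := int_add_half_ne_zero (n + 1)
  push_cast at h
  convert h using 1
  ring

theorem shiftedFactorial_neg_one_half_add_one (n : ℤ) :
    shiftedFactorial (-(1 / 2)) (n + 1) = (-(1 / 2) + n) * shiftedFactorial (-(1 / 2)) n := by
  apply shiftedFactorial_add_one
  have h := int_add_half_ne_zero (n - 1)
  push_cast at h
  convert h using 1
  ring

theorem toNat_factorial_add_one {n : ℤ} (h : 0 ≤ n) :
    ((n + 1).toNat.factorial : ℝ) = (n + 1) * (n.toNat.factorial : ℝ) := by
  lift n to ℕ using h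
  have h1 : ((n : ℤ) + 1).toNat = n + 1 := by omega
  rw [h1, Nat.factorial_succ]
  simp

/-- The summand with the linear factor `8 * k + 6 * p + 3` removed. -/
noncomputable def reducedTerm (q p : ℤ) (k : ℕ) : ℝ :=
  shiftedFactorial (1 / 2) (p + 2 * q + 1) *
    (shiftedFactorial (3 / 2) (k + 3 * p) * shiftedFactorial (3 / 2) (k + 3 * q) *
      shiftedFactorial (-(1 / 2)) (2 * k - 3 * q)) /
    ((k.factorial : ℝ) * ((k + p - q).toNat.factorial : ℝ) *
      ((2 * k + 3 * p + 3 * q + 2).toNat.factorial : ℝ)) / 9 ^ k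

/-- The summand, including the prefactor of the series. -/
noncomputable def seriesTerm (q p : ℤ) (k : ℕ) : ℝ :=
  reducedTerm q p k * (8 * k + 6 * p + 3)

theorem reducedTerm_succ {p q : ℤ} (h₁ : 0 ≤ p + q) (h₂ : 0 ≤ p - q) (k : ℕ) :
    reducedTerm q p (k + 1) = reducedTerm q p k *
      ((k + 3 * p + 3 / 2) * (k + 3 * q + 3 / 2) * (2 * k - 3 * q - 1 / 2) *
        (2 * k - 3 * q + 1 / 2) /
      (9 * (k + 1) * (k + p - q + 1) * (2 * k + 3 * p + 3 * q + 3) *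
        (2 * k + 3 * p + 3 * q + 4))) := by
  have h₁' : (0 : ℝ) ≤ p + q := by exact_mod_cast h₁
  have h₂' : (0 : ℝ) ≤ p - q := by exact_mod_cast h₂
  have hk : (0 : ℝ) ≤ k := k.cast_nonneg
  have e1 : ((k + 1 : ℕ) : ℤ) + 3 * p = (k + 3 * p) + 1 := by push_cast; ring
  have e2 : ((k + 1 : ℕ) : ℤ) + 3 * q = (k + 3 * q) + 1 := by push_cast; ring
  have e3 : 2 * ((k + 1 : ℕ) : ℤ) - 3 * q = (2 * k - 3 * q) + 1 + 1 := by push_cast; ring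
  have e4 : ((k + 1 : ℕ) : ℤ) + p - q = (k + p - q) + 1 := by push_cast; ring
  have e5 : 2 * ((k + 1 : ℕ) : ℤ) + 3 * p + 3 * q + 2 =
    (2 * k + 3 * p + 3 * q + 2) + 1 + 1 := by push_cast; ring
  unfold reducedTerm
  rw [e1, e2, e3, e4, e5, shiftedFactorial_three_halves_add_one,
    shiftedFactorial_three_halves_add_one, shiftedFactorial_neg_one_half_add_one,
    shiftedFactorial_neg_one_half_add_one, toNat_factorial_add_one (by omega),
    toNat_factorial_add_one (by omega), toNat_factorial_add_one (by omega),
    Nat.factorial_succ]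
  have n1 : (k : ℝ) + 1 ≠ 0 := by positivity
  have n2 : (k : ℝ) + p - q + 1 ≠ 0 := by linarith
  have n3 : 2 * (k : ℝ) + 3 * p + 3 * q + 2 + 1 ≠ 0 := by linarith
  have n4 : 2 * (k : ℝ) + 3 * p + 3 * q + 2 + 1 + 1 ≠ 0 := by linarith
  have r3 : 2 * (k : ℝ) + 3 * p + 3 * q + 3 = 2 * k + 3 * p + 3 * q + 2 + 1 := by ring
  have r4 : 2 * (k : ℝ) + 3 * p + 3 * q + 4 = 2 * k + 3 * p + 3 * q + 2 + 1 + 1 := by ring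
  rw [r3, r4]
  push_cast
  field_simp
  ring

theorem reducedTerm_add_one {p q : ℤ} (h₁ : 0 ≤ p + q) (h₂ : 0 ≤ p - q) (k : ℕ) :
    reducedTerm q (p + 1) k = reducedTerm q p k *
      ((p + 2 * q + 3 / 2) * (k + 3 * p + 3 / 2) * (k + 3 * p + 5 / 2) * (k + 3 * p + 7 / 2) /
      ((k + p - q + 1) * (2 * k + 3 * p + 3 * q + 3) * (2 * k + 3 * p + 3 * q + 4) *
        (2 * k + 3 * p + 3 * q + 5))) := by
  have h₁' : (0 : ℝ) ≤ p + q := by exact_mod_cast h₁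
  have h₂' : (0 : ℝ) ≤ p - q := by exact_mod_cast h₂
  have hk : (0 : ℝ) ≤ k := k.cast_nonneg
  have e1 : p + 1 + 2 * q + 1 = (p + 2 * q + 1) + 1 := by ring
  have e2 : (k : ℤ) + 3 * (p + 1) = (k + 3 * p) + 1 + 1 + 1 := by ring
  have e4 : (k : ℤ) + (p + 1) - q = (k + p - q) + 1 := by ring
  have e5 : 2 * (k : ℤ) + 3 * (p + 1) + 3 * q + 2 =
    (2 * k + 3 * p + 3 * q + 2) + 1 + 1 + 1 := by ring
  unfold reducedTerm
  rw [e1, e2, e4, e5, shiftedFactorial_one_half_add_one (p + 2 * q + 1),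
    shiftedFactorial_three_halves_add_one,
    shiftedFactorial_three_halves_add_one, shiftedFactorial_three_halves_add_one,
    toNat_factorial_add_one (by omega), toNat_factorial_add_one (by omega),
    toNat_factorial_add_one (by omega), toNat_factorial_add_one (by omega)]
  have n2 : (k : ℝ) + p - q + 1 ≠ 0 := by linarith
  have n3 : 2 * (k : ℝ) + 3 * p + 3 * q + 2 + 1 ≠ 0 := by linarith
  have n4 : 2 * (k : ℝ) + 3 * p + 3 * q + 2 + 1 + 1 ≠ 0 := by linarith
  have n5 : 2 * (k : ℝ) + 3 * p + 3 * q + 2 + 1 + 1 + 1 ≠ 0 := by linarith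
  have r3 : 2 * (k : ℝ) + 3 * p + 3 * q + 3 = 2 * k + 3 * p + 3 * q + 2 + 1 := by ring
  have r4 : 2 * (k : ℝ) + 3 * p + 3 * q + 4 = 2 * k + 3 * p + 3 * q + 2 + 1 + 1 := by ring
  have r5 : 2 * (k : ℝ) + 3 * p + 3 * q + 5 = 2 * k + 3 * p + 3 * q + 2 + 1 + 1 + 1 := by ring
  rw [r3, r4, r5]
  push_cast
  field_simp
  ring

/-- The Wilf–Zeilberger companion of `seriesTerm` with respect to the shift of `p`. -/
noncomputable def companion (q p : ℤ) (k : ℕ) : ℝ :=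
  reducedTerm q p k *
    (9 * k * (2 * k + 4 * p + 2 * q + 3) / (2 * k + 3 * p + 3 * q + 3))

theorem companion_sub {p q : ℤ} (h₁ : 0 ≤ p + q) (h₂ : 0 ≤ p - q) (k : ℕ) :
    companion q p (k + 1) - companion q p k =
      seriesTerm q (p + 1) k - seriesTerm q p k := by
  have h₁' : (0 : ℝ) ≤ p + q := by exact_mod_cast h₁
  have h₂' : (0 : ℝ) ≤ p - q := by exact_mod_cast h₂
  have hk : (0 : ℝ) ≤ k := k.cast_nonneg
  unfold companion seriesTerm
  rw [reducedTerm_succ h₁ h₂, reducedTerm_add_one h₁ h₂]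
  have n1 : (k : ℝ) + 1 ≠ 0 := by positivity
  push_cast
  generalize reducedTerm q p k = t
  obtain ⟨x, hx⟩ : ∃ x : ℝ, x = 2 * k + 3 * p + 3 * q := ⟨_, rfl⟩
  obtain ⟨y, hy⟩ : ∃ y : ℝ, y = k + p - q := ⟨_, rfl⟩
  have r5 : 2 * ((k : ℝ) + 1) + 3 * p + 3 * q + 3 = x + 5 := by rw [hx]; ring
  rw [r5, ← hx, ← hy]
  have n2 : y + 1 ≠ 0 := by linarith
  have n3 : x + 3 ≠ 0 := by linarith
  have n4 : x + 4 ≠ 0 := by linarith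
  have n5 : x + 5 ≠ 0 := by linarith
  field_simp
  rw [hx, hy]
  ring

/-- A `p`-independent majorant for `(k + p - q + 1)` times the modulus of the ratio of consecutive
summands. -/
noncomputable def ratioMajorant (q : ℤ) (k : ℕ) : ℝ :=
  (2 * k + 3 + 3 * |(q : ℝ)|) / (2 * k + 3) *
    ((k + 3 * |(q : ℝ)| + 2) * ((2 * k + 3 * |(q : ℝ)| + 1) * (2 * k + 3 * |(q : ℝ)| + 1)) /
      ((k + 1) * (2 * k + 3))) * ((8 * k + 11) / (8 * k + 3)) / 9

theorem ratioMajorant_nonneg (q : ℤ) (k : ℕ) : 0 ≤ ratioMajorant q k := by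
  unfold ratioMajorant
  positivity

theorem tendsto_ratioMajorant_div (q : ℤ) :
    Tendsto (fun k : ℕ ↦ ratioMajorant q k / (k + 1)) atTop (𝓝 (2 / 9)) := by
  have L (a b c d : ℝ) (hd : d ≠ 0) :=
    tendsto_add_mul_div_add_mul_atTop_nhds (𝕜 := ℝ) a b c hd
  have h := ((((L (3 + 3 * |(q : ℝ)|) 3 2 2 two_ne_zero).mul
    (L (3 * |(q : ℝ)| + 2) 1 1 1 one_ne_zero)).mul
    (L (3 * |(q : ℝ)| + 1) 1 2 1 one_ne_zero)).mul
    (L (3 * |(q : ℝ)| + 1) 3 2 2 two_ne_zero)).mul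
    ((L 11 3 8 8 (by norm_num)).div_const 9)
  convert h using 2 with k
  · unfold ratioMajorant
    have n1 : (k : ℝ) + 1 ≠ 0 := by positivity
    have n2 : 1 + (k : ℝ) ≠ 0 := by positivity
    have n3 : 2 * (k : ℝ) + 3 ≠ 0 := by positivity
    have n4 : 8 * (k : ℝ) + 3 ≠ 0 := by positivity
    rw [show (3 : ℝ) + 2 * k = 2 * k + 3 by ring, show (3 : ℝ) + 8 * k = 8 * k + 3 by ring,
      show (1 : ℝ) + 1 * k = k + 1 by ring]
    field_simp
    ring
  · norm_num

theorem abs_seriesTerm_succ_le {p q : ℤ} (h₁ : 0 ≤ p + q) (h₂ : 0 ≤ p - q) (k : ℕ) :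
    |seriesTerm q p (k + 1)| ≤
      ratioMajorant q k / (k + p - q + 1) * |seriesTerm q p k| := by
  have h₁' : (0 : ℝ) ≤ p + q := by exact_mod_cast h₁
  have h₂' : (0 : ℝ) ≤ p - q := by exact_mod_cast h₂
  have hk : (0 : ℝ) ≤ k := k.cast_nonneg
  have hq₁ := le_abs_self (q : ℝ)
  have hq₂ := neg_abs_le (q : ℝ)
  have m1 : 0 < (k : ℝ) + 1 := by positivity
  have m2 : 0 < (k : ℝ) + p - q + 1 := by linarith
  have m3 : 0 < 2 * (k : ℝ) + 3 * p + 3 * q + 3 := by linarith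
  have m4 : 0 < 2 * (k : ℝ) + 3 * p + 3 * q + 4 := by linarith
  have m5 : 0 < 8 * (k : ℝ) + 6 * p + 3 := by linarith
  have e : seriesTerm q p (k + 1) =
      (k + 3 * p + 3 / 2) / (2 * k + 3 * p + 3 * q + 3) *
      ((k + 3 * q + 3 / 2) * ((2 * k - 3 * q - 1 / 2) * (2 * k - 3 * q + 1 / 2)) /
        ((k + 1) * (2 * k + 3 * p + 3 * q + 4))) *
      ((8 * k + 6 * p + 11) / (8 * k + 6 * p + 3)) / 9 / (k + p - q + 1) *
      seriesTerm q p k := by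
    unfold seriesTerm
    rw [reducedTerm_succ h₁ h₂]
    generalize reducedTerm q p k = t
    push_cast
    rw [show 8 * ((k : ℝ) + 1) + 6 * p + 3 = 8 * k + 6 * p + 11 by ring]
    generalize 2 * (k : ℝ) + 3 * p + 3 * q + 3 = x at *
    generalize 2 * (k : ℝ) + 3 * p + 3 * q + 4 = x' at *
    generalize (k : ℝ) + p - q + 1 = y at *
    generalize 8 * (k : ℝ) + 6 * p + 3 = z at *
    field_simp
  rw [e, abs_mul]
  refine mul_le_mul_of_nonneg_right ?_ (abs_nonneg _)
  rw [abs_div, abs_of_pos m2]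
  refine div_le_div_of_nonneg_right ?_ m2.le
  rw [abs_div, abs_mul, abs_mul, abs_of_pos (show (0 : ℝ) < 9 by norm_num)]
  unfold ratioMajorant
  refine div_le_div_of_nonneg_right ?_ (by norm_num)
  refine mul_le_mul (mul_le_mul ?_ ?_ (abs_nonneg _) (by positivity)) ?_ (abs_nonneg _)
    (by positivity)
  · rw [abs_of_nonneg (div_nonneg (by linarith) m3.le), div_le_div_iff₀ m3 (by positivity)]
    have := mul_nonneg (abs_nonneg (q : ℝ)) h₁'
    nlinarith
  · rw [abs_div, abs_mul, abs_mul, abs_of_pos (mul_pos m1 m4)]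
    refine div_le_div₀ (by positivity) ?_ (by positivity)
      (mul_le_mul_of_nonneg_left (by linarith) m1.le)
    refine mul_le_mul ?_ (mul_le_mul ?_ ?_ (abs_nonneg _) (by positivity)) (by positivity)
      (by positivity)
    all_goals rw [abs_le]; constructor <;> linarith
  · rw [abs_of_nonneg (div_nonneg (by linarith) m5.le), div_le_div_iff₀ m5 (by positivity)]
    nlinarith

/-- The product of the ratio bounds, dominating the series uniformly in `p`. -/
noncomputable def termMajorant (q : ℤ) (k : ℕ) : ℝ :=
  ∏ j ∈ Finset.range k, (ratioMajorant q j / (j + 1))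

theorem termMajorant_pos (q : ℤ) (k : ℕ) : 0 < termMajorant q k := by
  refine Finset.prod_pos fun j _ ↦ ?_
  unfold ratioMajorant
  positivity

theorem summable_termMajorant (q : ℤ) : Summable (termMajorant q) := by
  have hpos := termMajorant_pos q
  refine summable_of_ratio_test_tendsto_lt_one (l := 2 / 9) (by norm_num)
    (Eventually.of_forall fun k ↦ (hpos k).ne') ?_
  convert tendsto_ratioMajorant_div q using 2 with k
  rw [Real.norm_of_nonneg (hpos _).le, Real.norm_of_nonneg (hpos _).le,
    div_eq_iff (hpos k).ne', mul_comm]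
  exact Finset.prod_range_succ _ _

theorem abs_seriesTerm_le {p q : ℤ} (h₁ : 0 ≤ p + q) (h₂ : 0 ≤ p - q) (k : ℕ) :
    |seriesTerm q p k| ≤ |seriesTerm q p 0| * termMajorant q k := by
  have h₂' : (0 : ℝ) ≤ p - q := by exact_mod_cast h₂
  induction k with
  | zero => simp [termMajorant]
  | succ k ih =>
    refine (abs_seriesTerm_succ_le h₁ h₂ k).trans ?_
    rw [termMajorant, Finset.prod_range_succ, mul_comm]
    rw [termMajorant] at ih
    rw [← mul_assoc]
    have hb := ratioMajorant_nonneg q k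
    have hk : (0 : ℝ) < k + 1 := by positivity
    refine mul_le_mul ih ?_ (div_nonneg hb (by linarith)) ((abs_nonneg _).trans ih)
    exact div_le_div_of_nonneg_left hb hk (by linarith)

theorem summable_seriesTerm {p q : ℤ} (h₁ : 0 ≤ p + q) (h₂ : 0 ≤ p - q) :
    Summable (seriesTerm q p) :=
  Summable.of_norm_bounded ((summable_termMajorant q).mul_left _) (abs_seriesTerm_le h₁ h₂)

theorem tendsto_companion {p q : ℤ} (h₁ : 0 ≤ p + q) (h₂ : 0 ≤ p - q) :
    Tendsto (companion q p) atTop (𝓝 0) := by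
  have h₁' : (0 : ℝ) ≤ p + q := by exact_mod_cast h₁
  have h₂' : (0 : ℝ) ≤ p - q := by exact_mod_cast h₂
  have h := ((summable_seriesTerm h₁ h₂).tendsto_atTop_zero.norm).const_mul (2 * (1 + (p - q : ℝ)))
  rw [norm_zero, mul_zero] at h
  refine squeeze_zero_norm (fun k ↦ ?_) h
  have hk : (0 : ℝ) ≤ k := k.cast_nonneg
  have m3 : 0 < 2 * (k : ℝ) + 3 * p + 3 * q + 3 := by linarith
  have m5 : 0 < 8 * (k : ℝ) + 6 * p + 3 := by linarith
  have m6 : 0 ≤ 2 * (k : ℝ) + 4 * p + 2 * q + 3 := by linarith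
  unfold companion seriesTerm
  rw [norm_mul, norm_mul, Real.norm_of_nonneg m5.le,
    Real.norm_of_nonneg (div_nonneg (mul_nonneg (by positivity) m6) m3.le),
    mul_left_comm (2 * (1 + (p - q : ℝ)))]
  refine mul_le_mul_of_nonneg_left ?_ (norm_nonneg _)
  rw [div_le_iff₀ m3]
  have a1 : 9 * (k : ℝ) ≤ 2 * (8 * (k : ℝ) + 6 * p + 3) := by linarith
  have a2 : 2 * (k : ℝ) + 4 * p + 2 * q + 3 ≤
      (1 + (p - q)) * (2 * (k : ℝ) + 3 * p + 3 * q + 3) := by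
    nlinarith [mul_nonneg h₂' (show 0 ≤ 2 * (k : ℝ) + 3 * p + 3 * q + 2 by linarith)]
  calc _ ≤ 2 * (8 * (k : ℝ) + 6 * p + 3) *
        ((1 + (p - q)) * (2 * (k : ℝ) + 3 * p + 3 * q + 3)) :=
        mul_le_mul a1 a2 m6 (by positivity)
    _ = _ := by ring

theorem tsum_seriesTerm_add_one {p q : ℤ} (h₁ : 0 ≤ p + q) (h₂ : 0 ≤ p - q) :
    ∑' k, seriesTerm q (p + 1) k = ∑' k, seriesTerm q p k := by
  have s₁ := summable_seriesTerm (p := p + 1) (q := q) (by omega) (by omega)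
  have s₂ := summable_seriesTerm h₁ h₂
  rw [← sub_eq_zero, ← s₁.tsum_sub s₂]
  refine tendsto_nhds_unique (s₁.sub s₂).hasSum.tendsto_sum_nat ?_
  convert tendsto_companion h₁ h₂ using 2 with n
  simp_rw [← companion_sub h₁ h₂, Finset.sum_range_sub]
  simp [companion]

theorem tsum_seriesTerm_add_natCast {p q : ℤ} (h₁ : 0 ≤ p + q) (h₂ : 0 ≤ p - q) (j : ℕ) :
    ∑' k, seriesTerm q (p + j) k = ∑' k, seriesTerm q p k := by
  induction j with
  | zero => simp
  | succ j ih =>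
    rw [← ih, ← tsum_seriesTerm_add_one (p := p + j) (by omega) (by omega)]
    push_cast
    rw [add_assoc]

theorem Gamma_add_natCast_add_one {s : ℝ} (hs : ∀ m : ℕ, s ≠ -m) (n : ℕ) :
    Real.Gamma (s + n + 1) = Real.Gamma s * ∏ j ∈ Finset.range (n + 1), (s + j) := by
  induction n with
  | zero =>
    have h : s ≠ 0 := by simpa using hs 0
    simp [Real.Gamma_add_one h, mul_comm]
  | succ n ih =>
    have h : s + n + 1 ≠ 0 := fun h ↦ hs (n + 1) (by push_cast; linarith)
    rw [Finset.prod_range_succ, ← mul_assoc, ← ih]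
    push_cast
    rw [← add_assoc, Real.Gamma_add_one h, mul_comm]

theorem tendsto_Gamma_div_rpow_mul_factorial {s : ℝ} (hs : ∀ m : ℕ, s ≠ -m) :
    Tendsto (fun n : ℕ ↦ Real.Gamma (s + n + 1) / ((n : ℝ) ^ s * n.factorial)) atTop (𝓝 1) := by
  have h0 := Real.Gamma_ne_zero hs
  have h := (tendsto_const_nhds (x := Real.Gamma s)).div
    (Real.GammaSeq_tendsto_Gamma s) h0
  rw [div_self h0] at h
  convert h using 2 with n
  rw [Gamma_add_natCast_add_one hs, Pi.div_apply, Real.GammaSeq, div_div_eq_mul_div]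

theorem Gamma_three_halves_mul_Gamma_neg_one_half :
    Real.Gamma (3 / 2) * Real.Gamma (-(1 / 2)) = -Real.pi := by
  have h := Real.Gamma_mul_Gamma_one_sub (3 / 2)
  have e : Real.pi * (3 / 2) = Real.pi / 2 + Real.pi := by ring
  rw [e, Real.sin_add_pi, Real.sin_pi_div_two, div_neg, div_one] at h
  rw [← h]
  norm_num

theorem shiftedFactorial_mul_shiftedFactorial_neg (q : ℤ) :
    shiftedFactorial (3 / 2) (3 * q) * shiftedFactorial (-(1 / 2)) (-(3 * q)) = (-1) ^ q := by
  have h := Real.Gamma_mul_Gamma_one_sub (3 / 2 + ((3 * q : ℤ) : ℝ))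
  have e₁ : Real.pi * (3 / 2 + ((3 * q : ℤ) : ℝ)) =
    Real.pi / 2 + Real.pi + ((3 * q : ℤ) : ℝ) * Real.pi := by ring
  have e₂ : 1 - (3 / 2 + ((3 * q : ℤ) : ℝ)) = -(1 / 2) + ((-(3 * q) : ℤ) : ℝ) := by
    push_cast; ring
  rw [e₁, e₂, Real.sin_add_int_mul_pi, Real.sin_add_pi, Real.sin_pi_div_two] at h
  unfold shiftedFactorial
  rw [div_mul_div_comm, h, Gamma_three_halves_mul_Gamma_neg_one_half]
  have hodd : (-1 : ℝ) ^ (3 * q) = (-1) ^ q := by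
    rw [zpow_mul]
    norm_num
  rw [hodd]
  have hpi := Real.pi_ne_zero
  have hu : (-1 : ℝ) ^ q * (-1) ^ q = 1 := by
    rw [← mul_zpow]
    norm_num
  have h0 : (-1 : ℝ) ^ q ≠ 0 := left_ne_zero_of_mul_eq_one hu
  field_simp
  linarith

theorem Gamma_one_half_mul_Gamma_three_halves :
    Real.Gamma (1 / 2) * Real.Gamma (3 / 2) = Real.pi / 2 := by
  have h := Real.Gamma_add_one (s := 1 / 2) (by norm_num)
  rw [show (3 / 2 : ℝ) = 1 / 2 + 1 by norm_num, h, Real.Gamma_one_half_eq]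
  have := Real.mul_self_sqrt Real.pi_pos.le
  linarith

theorem tendsto_seriesTerm_zero {p q : ℤ} (h₁ : 0 ≤ p + q) (h₂ : 0 ≤ p - q) :
    Tendsto (fun j : ℕ ↦ seriesTerm q (p + j) 0) atTop
      (𝓝 (4 * (-1) ^ q / (3 ^ (3 * (q : ℝ) + 1 / 2) * Real.pi))) := by
  obtain ⟨a, ha⟩ := Int.eq_ofNat_of_zero_le h₂
  obtain ⟨b, hb⟩ := Int.eq_ofNat_of_zero_le h₁
  have ha' : (p : ℝ) - q = a := by exact_mod_cast ha
  have hb' : (p : ℝ) + q = b := by exact_mod_cast hb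
  set s : ℝ := 3 * q + 1 / 2 with hs
  have hs₁ (m : ℕ) : s ≠ -m := by
    have h := int_add_half_ne_zero (3 * q + m)
    push_cast at h
    intro h'
    exact h (by linarith)
  have hs₂ (m : ℕ) : -(s + 1) ≠ -m := by
    have h := int_add_half_ne_zero (3 * q + 1 - m)
    push_cast at h
    intro h'
    exact h (by linarith)
  have tn : Tendsto (fun j : ℕ ↦ a + j) atTop atTop := tendsto_atTop_mono (by simp) tendsto_id
  have tN : Tendsto (fun j : ℕ ↦ 3 * b + 2 + 3 * j) atTop atTop :=
    tendsto_atTop_mono (fun j ↦ by simp only [id]; omega) tendsto_id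
  have t₁ := (tendsto_Gamma_div_rpow_mul_factorial hs₁).comp tn
  have t₂ := (tendsto_Gamma_div_rpow_mul_factorial hs₂).comp tN
  have t₃ : Tendsto (fun j : ℕ ↦ (((a + j : ℕ) : ℝ) / ((3 * b + 2 + 3 * j : ℕ) : ℝ)) ^ s) atTop
      (𝓝 ((1 / 3) ^ s)) := by
    refine Tendsto.rpow_const ?_ (Or.inl (by norm_num))
    convert tendsto_add_mul_div_add_mul_atTop_nhds (𝕜 := ℝ) a (3 * b + 2) 1 three_ne_zero
      using 2 with j
    push_cast
    ring
  have t₄ : Tendsto (fun j : ℕ ↦ (6 * p + 6 * j + 3 : ℝ) / ((3 * b + 2 + 3 * j : ℕ) : ℝ)) atTop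
      (𝓝 2) := by
    convert tendsto_add_mul_div_add_mul_atTop_nhds (𝕜 := ℝ) (6 * p + 3) (3 * b + 2) 6
      three_ne_zero using 2 with j
    · push_cast
      ring
    · norm_num
  have t := (((t₁.mul t₂).mul t₃).mul t₄).const_mul
    ((-1 : ℝ) ^ q / (Real.Gamma (1 / 2) * Real.Gamma (3 / 2)))
  have hlim : (-1 : ℝ) ^ q / (Real.Gamma (1 / 2) * Real.Gamma (3 / 2)) *
      (1 * 1 * (1 / 3) ^ s * 2) = 4 * (-1) ^ q / (3 ^ s * Real.pi) := by
    rw [Gamma_one_half_mul_Gamma_three_halves, Real.div_rpow zero_le_one zero_le_three,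
      Real.one_rpow]
    have := Real.pi_ne_zero
    have : (3 : ℝ) ^ s ≠ 0 := (Real.rpow_pos_of_pos three_pos s).ne'
    field_simp
    ring
  rw [hlim] at t
  refine t.congr' ?_
  filter_upwards [eventually_ge_atTop 1] with j hj
  have e₁ : (1 / 2 : ℝ) + ((p + j + 2 * q + 1 : ℤ) : ℝ) = s + (a + j : ℕ) + 1 := by
    push_cast
    rw [hs, ← ha']
    ring
  have e₂ : (3 / 2 : ℝ) + ((((0 : ℕ) : ℤ) + 3 * (p + j) : ℤ) : ℝ) =
      -(s + 1) + (3 * b + 2 + 3 * j : ℕ) + 1 := by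
    push_cast
    rw [hs, ← hb']
    ring
  have e₃ : (((0 : ℕ) : ℤ) + (p + j) - q).toNat = a + j := by omega
  have e₄ : (2 * ((0 : ℕ) : ℤ) + 3 * (p + j) + 3 * q + 2).toNat = 3 * b + 2 + 3 * j := by omega
  have e₅ : ((0 : ℕ) : ℤ) + 3 * q = 3 * q := by simp
  have e₆ : 2 * ((0 : ℕ) : ℤ) - 3 * q = -(3 * q) := by simp
  unfold seriesTerm reducedTerm
  rw [e₃, e₄, e₅, e₆, mul_assoc (shiftedFactorial (3 / 2) (((0 : ℕ) : ℤ) + 3 * (p + j))),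
    shiftedFactorial_mul_shiftedFactorial_neg]
  unfold shiftedFactorial
  rw [e₁, e₂]
  simp only [Function.comp_apply]
  have hn : (0 : ℝ) < ((a + j : ℕ) : ℝ) := by exact_mod_cast (by omega : 0 < a + j)
  have hN : (0 : ℝ) < ((3 * b + 2 + 3 * j : ℕ) : ℝ) := by
    exact_mod_cast (by omega : 0 < 3 * b + 2 + 3 * j)
  have hnf : ((a + j).factorial : ℝ) ≠ 0 := by positivity
  have hNf : ((3 * b + 2 + 3 * j).factorial : ℝ) ≠ 0 := by positivity
  generalize ((a + j : ℕ) : ℝ) = n at *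
  generalize ((3 * b + 2 + 3 * j : ℕ) : ℝ) = N at *
  rw [Real.rpow_neg hN.le, Real.rpow_add hN, Real.rpow_one, Real.div_rpow hn.le hN.le]
  have hns : n ^ s ≠ 0 := (Real.rpow_pos_of_pos hn s).ne'
  have hNs : N ^ s ≠ 0 := (Real.rpow_pos_of_pos hN s).ne'
  have g₁ : Real.Gamma (1 / 2) ≠ 0 := (Real.Gamma_pos_of_pos (by norm_num)).ne'
  have g₂ : Real.Gamma (3 / 2) ≠ 0 := (Real.Gamma_pos_of_pos (by norm_num)).ne'
  push_cast
  simp only [Nat.factorial_zero, Nat.cast_one, pow_zero, mul_zero, zero_add, one_mul, div_one]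
  field_simp

theorem tendsto_seriesTerm_succ {p q : ℤ} (h₁ : 0 ≤ p + q) (h₂ : 0 ≤ p - q) {M : ℝ}
    (hM : ∀ᶠ j : ℕ in atTop, |seriesTerm q (p + j) 0| ≤ M) (k : ℕ) :
    Tendsto (fun j : ℕ ↦ seriesTerm q (p + j) (k + 1)) atTop (𝓝 0) := by
  have h₂' : (0 : ℝ) ≤ p - q := by exact_mod_cast h₂
  have hlim : Tendsto (fun j : ℕ ↦ ratioMajorant q k / ((j : ℝ) + 1) * (M * termMajorant q k))
      atTop (𝓝 0) := by
    have h := (tendsto_one_div_add_atTop_nhds_zero_nat (𝕜 := ℝ)).const_mul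
      (ratioMajorant q k * (M * termMajorant q k))
    rw [mul_zero] at h
    refine h.congr fun j ↦ ?_
    ring
  refine squeeze_zero_norm' ?_ hlim
  filter_upwards [hM] with j hj
  have hb := ratioMajorant_nonneg q k
  have hk : (0 : ℝ) ≤ k := k.cast_nonneg
  refine (abs_seriesTerm_succ_le (by omega) (by omega) k).trans ?_
  refine mul_le_mul ?_ ?_ (abs_nonneg _) (by positivity)
  · refine div_le_div_of_nonneg_left hb (by positivity) ?_
    push_cast
    linarith
  · refine (abs_seriesTerm_le (by omega) (by omega) k).trans ?_
    exact mul_le_mul_of_nonneg_right hj (termMajorant_pos q k).le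

theorem tsum_seriesTerm {p q : ℤ} (h₁ : 0 ≤ p + q) (h₂ : 0 ≤ p - q) :
    ∑' k, seriesTerm q p k = 4 * (-1) ^ q / (3 ^ (3 * (q : ℝ) + 1 / 2) * Real.pi) := by
  have h0 := tendsto_seriesTerm_zero h₁ h₂
  set L : ℝ := 4 * (-1) ^ q / (3 ^ (3 * (q : ℝ) + 1 / 2) * Real.pi)
  have hM : ∀ᶠ j : ℕ in atTop, |seriesTerm q (p + j) 0| ≤ |L| + 1 :=
    h0.abs.eventually_le_const (lt_add_one _)
  have hlim : Tendsto (fun j : ℕ ↦ ∑' k, seriesTerm q (p + j) k) atTop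
      (𝓝 (∑' k, if k = 0 then L else 0)) := by
    refine tendsto_tsum_of_dominated_convergence ((summable_termMajorant q).mul_left (|L| + 1))
      (fun k ↦ ?_) ?_
    · cases k with
      | zero => simpa using h0
      | succ k => simpa using tendsto_seriesTerm_succ h₁ h₂ hM k
    · filter_upwards [hM] with j hj k
      refine (abs_seriesTerm_le (by omega) (by omega) k).trans ?_
      exact mul_le_mul_of_nonneg_right hj (termMajorant_pos q k).le
  simp_rw [tsum_seriesTerm_add_natCast h₁ h₂, tsum_ite_eq] at hlim
  exact tendsto_nhds_unique tendsto_const_nhds hlim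

theorem wei_gong_thm6 (p q : ℤ)
    (h : 0 ≤ min (p + q) (p - q)) :
    4 * (-1 : ℝ) ^ q / ((3 : ℝ) ^ ((3*(q : ℝ)) + 1/2) * Real.pi) =
      shiftedFactorial (1/2) (p + 2*q + 1) *
      ∑' k : ℕ,
        (shiftedFactorial (3/2) ((k : ℤ) + 3*p) * shiftedFactorial (3/2) ((k : ℤ) + 3*q) *
          shiftedFactorial (-(1/2)) (2*(k : ℤ) - 3*q)) /
        ((k.factorial : ℝ) * (((k : ℤ) + p - q).toNat.factorial : ℝ) *
          ((2*(k : ℤ) + 3*p + 3*q + 2).toNat.factorial : ℝ)) *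
        ((8*(k : ℝ) + 6*(p : ℝ) + 3) / (9 : ℝ) ^ k) := by
  have h₁ : 0 ≤ p + q := h.trans (min_le_left _ _)
  have h₂ : 0 ≤ p - q := h.trans (min_le_right _ _)
  rw [← tsum_seriesTerm h₁ h₂, ← tsum_mul_left]
  refine tsum_congr fun k ↦ ?_
  unfold seriesTerm reducedTerm
  ring
end

section
/- For all integers p, q with min{p+q+1, p−q} ≥ 0, one has 8·(−1)^q/(3^{3q+5/2}·π) = (1/2)_{p+2q+2} · ∑_{k=0}^∞ [(5/2)_{k+3p} (5/2)_{k+3q} (−3/2)_{2k−3q}] / [k! · (k+p−q)! · (2k+3p+3q+4)!] · (8k+6p+5)/9^k. -/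
open Filter Topology

namespace WeiGong

/-- The Gamma function at the half-integer `n + 1/2`. -/
noncomputable def halfGamma (n : ℤ) : ℝ := Real.Gamma (n + 1 / 2)

/-- The factorial of an integer, with the value `1` at negative integers. -/
def intFactorial (n : ℤ) : ℝ := (n.toNat.factorial : ℝ)

theorem half_int_ne_zero (n : ℤ) : (n : ℝ) + 1 / 2 ≠ 0 := by
  intro h
  have h2 : ((2 * n + 1 : ℤ) : ℝ) = 0 := by push_cast; linarith
  have : 2 * n + 1 = 0 := by exact_mod_cast h2
  omega

theorem halfGamma_ne_zero (n : ℤ) : halfGamma n ≠ 0 := by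
  refine Real.Gamma_ne_zero fun m h => half_int_ne_zero (n + m) ?_
  push_cast
  linarith

theorem halfGamma_add_one (n : ℤ) : halfGamma (n + 1) = (n + 1 / 2) * halfGamma n := by
  unfold halfGamma
  rw [← Real.Gamma_add_one (half_int_ne_zero n)]
  congr 1
  push_cast
  ring

theorem halfGamma_mul_neg (n : ℤ) : halfGamma n * halfGamma (-n) = Real.pi * (-1) ^ n := by
  have h := Real.Gamma_mul_Gamma_one_sub ((n : ℝ) + 1 / 2)
  have hs : Real.sin (Real.pi * ((n : ℝ) + 1 / 2)) = (-1) ^ n := by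
    rw [← Real.cos_int_mul_pi, ← Real.sin_add_pi_div_two]
    congr 1
    ring
  rw [hs] at h
  unfold halfGamma
  rw [show ((-n : ℤ) : ℝ) + 1 / 2 = 1 - (n + 1 / 2) by push_cast; ring, h, div_eq_mul_inv,
    ← inv_zpow]
  norm_num

theorem intFactorial_ne_zero (n : ℤ) : intFactorial n ≠ 0 := by
  unfold intFactorial
  positivity

theorem intFactorial_add_one {n : ℤ} (hn : 0 ≤ n) :
    intFactorial (n + 1) = (n + 1) * intFactorial n := by
  obtain ⟨m, rfl⟩ := Int.eq_ofNat_of_zero_le hn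
  have : ((m : ℤ) + 1).toNat = m + 1 := by omega
  simp [intFactorial, this, Nat.factorial_succ]

theorem shiftedFactorial_half (m n : ℤ) :
    shiftedFactorial ((m : ℝ) + 1 / 2) n = halfGamma (n + m) / halfGamma m := by
  unfold shiftedFactorial halfGamma
  push_cast
  ring_nf

/-- The Gamma-function form of the summand. -/
noncomputable def term (p q : ℤ) (k : ℕ) : ℝ :=
  halfGamma (p + 2 * q + 2) * halfGamma (k + 3 * p + 2) * halfGamma (k + 3 * q + 2) *
    halfGamma (2 * k - 3 * q - 2) /
    (intFactorial k * intFactorial (k + p - q) * intFactorial (2 * k + 3 * p + 3 * q + 4)) *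
    ((8 * (k : ℝ) + 6 * p + 5) / 9 ^ k)

/-- The quotient of consecutive summands. -/
noncomputable def termRatio (p q : ℤ) (k : ℕ) : ℝ :=
  ((k + 3 * p + 5 / 2) / (k + p - q + 1)) * ((k + 3 * q + 5 / 2) / (k + 1)) *
    ((2 * k - 3 * q - 3 / 2) / (2 * k + 3 * p + 3 * q + 5)) *
    ((2 * k - 3 * q - 1 / 2) / (2 * k + 3 * p + 3 * q + 6)) *
    ((8 * k + 6 * p + 13) / (8 * k + 6 * p + 5)) / 9

/-- The rational certificate of the telescoping recurrence in `p`. -/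
noncomputable def certificate (p q : ℤ) (k : ℕ) : ℝ :=
  9 * (k / (2 * k + 3 * p + 3 * q + 5)) * ((2 * k + 4 * p + 2 * q + 5) / (8 * k + 6 * p + 5))

section recurrences

variable {p q : ℤ}

theorem cast_bounds (h₁ : 0 ≤ p + q + 1) (h₂ : 0 ≤ p - q) :
    (0 : ℝ) ≤ p + q + 1 ∧ (0 : ℝ) ≤ p - q ∧ (0 : ℝ) ≤ p := by
  have h₃ : 0 ≤ p := by omega
  exact ⟨by exact_mod_cast h₁, by exact_mod_cast h₂, by exact_mod_cast h₃⟩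

theorem term_succ (h₁ : 0 ≤ p + q + 1) (h₂ : 0 ≤ p - q) (k : ℕ) :
    term p q (k + 1) = term p q k * termRatio p q k := by
  obtain ⟨c₁, c₂, c₃⟩ := cast_bounds h₁ h₂
  have hk : (0 : ℝ) ≤ k := k.cast_nonneg
  have e₁ := halfGamma_add_one (k + 3 * p + 2)
  have e₂ := halfGamma_add_one (k + 3 * q + 2)
  have e₃ := halfGamma_add_one (2 * k - 3 * q - 2)
  have e₄ := halfGamma_add_one (2 * k - 3 * q - 2 + 1)
  have f₁ := intFactorial_add_one (n := k) (by omega)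
  have f₂ := intFactorial_add_one (n := k + p - q) (by omega)
  have f₃ := intFactorial_add_one (n := 2 * k + 3 * p + 3 * q + 4) (by omega)
  have f₄ := intFactorial_add_one (n := 2 * k + 3 * p + 3 * q + 4 + 1) (by omega)
  unfold term termRatio
  rw [show ((k + 1 : ℕ) : ℤ) + 3 * p + 2 = k + 3 * p + 2 + 1 by push_cast; ring,
    show ((k + 1 : ℕ) : ℤ) + 3 * q + 2 = k + 3 * q + 2 + 1 by push_cast; ring,
    show 2 * ((k + 1 : ℕ) : ℤ) - 3 * q - 2 = 2 * k - 3 * q - 2 + 1 + 1 by push_cast; ring,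
    show ((k + 1 : ℕ) : ℤ) + p - q = k + p - q + 1 by push_cast; ring,
    show 2 * ((k + 1 : ℕ) : ℤ) + 3 * p + 3 * q + 4 = 2 * k + 3 * p + 3 * q + 4 + 1 + 1 by
      push_cast; ring,
    show ((k + 1 : ℕ) : ℤ) = k + 1 by push_cast; ring,
    e₁, e₂, e₄, e₃, f₁, f₂, f₄, f₃]
  have g₁ := intFactorial_ne_zero k
  have g₂ := intFactorial_ne_zero (k + p - q)
  have g₃ := intFactorial_ne_zero (2 * k + 3 * p + 3 * q + 4)
  have d₁ : (k : ℝ) + 1 ≠ 0 := by positivity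
  have d₂ : (k : ℝ) + p - q + 1 ≠ 0 := by linarith
  have d₃ : 2 * (k : ℝ) + 3 * p + 3 * q + 5 ≠ 0 := by linarith
  have d₄ : 2 * (k : ℝ) + 3 * p + 3 * q + 6 ≠ 0 := by linarith
  have d₅ : 8 * (k : ℝ) + 6 * p + 5 ≠ 0 := by positivity
  have d₃' : 2 * (k : ℝ) + 3 * p + 3 * q + 4 + 1 ≠ 0 := by linarith
  have d₄' : 2 * (k : ℝ) + 3 * p + 3 * q + 4 + 1 + 1 ≠ 0 := by linarith
  push_cast
  rw [pow_succ]
  generalize halfGamma _ = a₁ at *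
  generalize halfGamma _ = a₂ at *
  generalize halfGamma _ = a₃ at *
  generalize halfGamma _ = a₄ at *
  generalize intFactorial _ = b₁ at *
  generalize intFactorial _ = b₂ at *
  generalize intFactorial _ = b₃ at *
  field_simp
  ring

theorem term_ne_zero (h₁ : 0 ≤ p + q + 1) (h₂ : 0 ≤ p - q) (k : ℕ) : term p q k ≠ 0 := by
  obtain ⟨c₁, c₂, c₃⟩ := cast_bounds h₁ h₂
  have d₅ : 8 * (k : ℝ) + 6 * p + 5 ≠ 0 := by positivity
  simp [term, halfGamma_ne_zero, intFactorial_ne_zero, d₅]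

theorem term_add_one_sub (h₁ : 0 ≤ p + q + 1) (h₂ : 0 ≤ p - q) (k : ℕ) :
    term (p + 1) q k - term p q k =
      certificate p q (k + 1) * term p q (k + 1) - certificate p q k * term p q k := by
  obtain ⟨c₁, c₂, c₃⟩ := cast_bounds h₁ h₂
  have hk : (0 : ℝ) ≤ k := k.cast_nonneg
  have d₁ : (k : ℝ) + 1 ≠ 0 := by positivity
  have d₂ : (k : ℝ) + p - q + 1 ≠ 0 := by linarith
  have d₃ : 2 * (k : ℝ) + 3 * p + 3 * q + 5 ≠ 0 := by linarith
  have d₄ : 2 * (k : ℝ) + 3 * p + 3 * q + 6 ≠ 0 := by linarith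
  have d₄' : 2 * (k : ℝ) + 3 * p + 3 * q + 7 ≠ 0 := by linarith
  have d₅ : 8 * (k : ℝ) + 6 * p + 5 ≠ 0 := by positivity
  have d₆ : 8 * (k : ℝ) + 6 * p + 13 ≠ 0 := by positivity
  have hp : term (p + 1) q k = term p q k *
      ((p + 2 * q + 5 / 2) * ((k + 3 * p + 5 / 2) * (k + 3 * p + 7 / 2) * (k + 3 * p + 9 / 2)) *
        (8 * k + 6 * p + 11) / ((k + p - q + 1) * (2 * k + 3 * p + 3 * q + 5) *
        (2 * k + 3 * p + 3 * q + 6) * (2 * k + 3 * p + 3 * q + 7) * (8 * k + 6 * p + 5))) := by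
    have e₁ := halfGamma_add_one (p + 2 * q + 2)
    have e₂ := halfGamma_add_one (k + 3 * p + 2)
    have e₃ := halfGamma_add_one (k + 3 * p + 2 + 1)
    have e₄ := halfGamma_add_one (k + 3 * p + 2 + 1 + 1)
    have f₁ := intFactorial_add_one (n := k + p - q) (by omega)
    have f₂ := intFactorial_add_one (n := 2 * k + 3 * p + 3 * q + 4) (by omega)
    have f₃ := intFactorial_add_one (n := 2 * k + 3 * p + 3 * q + 4 + 1) (by omega)
    have f₄ := intFactorial_add_one (n := 2 * k + 3 * p + 3 * q + 4 + 1 + 1) (by omega)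
    unfold term
    rw [show p + 1 + 2 * q + 2 = p + 2 * q + 2 + 1 by ring,
      show (k : ℤ) + 3 * (p + 1) + 2 = k + 3 * p + 2 + 1 + 1 + 1 by ring,
      show (k : ℤ) + (p + 1) - q = k + p - q + 1 by ring,
      show 2 * (k : ℤ) + 3 * (p + 1) + 3 * q + 4 = 2 * k + 3 * p + 3 * q + 4 + 1 + 1 + 1 by ring,
      e₁, e₄, e₃, e₂, f₁, f₄, f₃, f₂]
    have g₁ := intFactorial_ne_zero k
    have g₂ := intFactorial_ne_zero (k + p - q)
    have g₃ := intFactorial_ne_zero (2 * k + 3 * p + 3 * q + 4)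
    have d₃' : 2 * (k : ℝ) + 3 * p + 3 * q + 4 + 1 ≠ 0 := by linarith
    have d₄' : 2 * (k : ℝ) + 3 * p + 3 * q + 4 + 1 + 1 ≠ 0 := by linarith
    have d₅' : 2 * (k : ℝ) + 3 * p + 3 * q + 4 + 1 + 1 + 1 ≠ 0 := by linarith
    push_cast
    generalize halfGamma _ = a₁ at *
    generalize halfGamma _ = a₂ at *
    generalize halfGamma _ = a₃ at *
    generalize halfGamma _ = a₄ at *
    generalize intFactorial _ = b₁ at *
    generalize intFactorial _ = b₂ at *
    generalize intFactorial _ = b₃ at *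
    field_simp
    ring
  rw [hp, term_succ h₁ h₂]
  unfold certificate termRatio
  push_cast
  rw [show 2 * ((k : ℝ) + 1) + 3 * p + 3 * q + 5 = 2 * k + 3 * p + 3 * q + 7 by ring,
    show 8 * ((k : ℝ) + 1) + 6 * p + 5 = 8 * k + 6 * p + 13 by ring]
  generalize hB : (k : ℝ) + p - q + 1 = B at *
  generalize hA₁ : 2 * (k : ℝ) + 3 * p + 3 * q + 5 = A₁ at *
  generalize hA₂ : 2 * (k : ℝ) + 3 * p + 3 * q + 6 = A₂ at *
  generalize hA₃ : 2 * (k : ℝ) + 3 * p + 3 * q + 7 = A₃ at *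
  generalize hC₁ : 8 * (k : ℝ) + 6 * p + 5 = C₁ at *
  generalize hC₂ : 8 * (k : ℝ) + 6 * p + 13 = C₂ at *
  field_simp
  subst hB hA₁ hA₂ hA₃ hC₁ hC₂
  ring

end recurrences

theorem tendsto_linear_div_linear (a b c d : ℝ) (hc : c ≠ 0) :
    Tendsto (fun n : ℕ => (a * n + b) / (c * n + d)) atTop (𝓝 (a / c)) := by
  have h := tendsto_inv_atTop_nhds_zero_nat (𝕜 := ℝ)
  have h1 : Tendsto (fun n : ℕ => (a + b * (n : ℝ)⁻¹) / (c + d * (n : ℝ)⁻¹)) atTop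
      (𝓝 ((a + b * 0) / (c + d * 0))) :=
    ((h.const_mul b).const_add a).div ((h.const_mul d).const_add c) (by simpa using hc)
  simp only [mul_zero, add_zero] at h1
  refine h1.congr' ?_
  filter_upwards [eventually_gt_atTop 0] with n hn
  have hn' : (n : ℝ) ≠ 0 := by positivity
  rw [← mul_div_mul_right _ _ hn', add_mul, add_mul, mul_assoc b, mul_assoc d,
    inv_mul_cancel₀ hn', mul_one, mul_one]

theorem tendsto_div_of_eq {f g : ℕ → ℝ} (a b c d : ℝ) {l : ℝ} (hc : c ≠ 0)
    (hf : ∀ n : ℕ, f n = a * n + b) (hg : ∀ n : ℕ, g n = c * n + d) (hl : a / c = l) :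
    Tendsto (fun n => f n / g n) atTop (𝓝 l) := by
  simpa only [hf, hg, hl] using tendsto_linear_div_linear a b c d hc

theorem tendsto_termRatio (p q : ℤ) : Tendsto (termRatio p q) atTop (𝓝 (1 / 9)) := by
  have h := (((((tendsto_div_of_eq (f := fun k => k + 3 * p + 5 / 2) (g := fun k => k + p - q + 1)
      1 (3 * p + 5 / 2) 1 (p - q + 1) (l := 1) (by norm_num) (by intros; ring) (by intros; ring)
      (by norm_num)).mul
    (tendsto_div_of_eq (f := fun k => k + 3 * q + 5 / 2) (g := fun k => k + 1)
      1 (3 * q + 5 / 2) 1 1 (l := 1) (by norm_num) (by intros; ring) (by intros; ring)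
      (by norm_num))).mul
    (tendsto_div_of_eq (f := fun k => 2 * k - 3 * q - 3 / 2)
      (g := fun k => 2 * k + 3 * p + 3 * q + 5)
      2 (- 3 * q - 3 / 2) 2 (3 * p + 3 * q + 5) (l := 1) (by norm_num) (by intros; ring)
      (by intros; ring) (by norm_num))).mul
    (tendsto_div_of_eq (f := fun k => 2 * k - 3 * q - 1 / 2)
      (g := fun k => 2 * k + 3 * p + 3 * q + 6)
      2 (- 3 * q - 1 / 2) 2 (3 * p + 3 * q + 6) (l := 1) (by norm_num) (by intros; ring)
      (by intros; ring) (by norm_num))).mul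
    (tendsto_div_of_eq (f := fun k => 8 * k + 6 * p + 13) (g := fun k => 8 * k + 6 * p + 5)
      8 (6 * p + 13) 8 (6 * p + 5) (l := 1) (by norm_num) (by intros; ring)
      (by intros; ring) (by norm_num))).div_const 9
  simp only [mul_one] at h
  exact h

theorem tendsto_certificate (p q : ℤ) : Tendsto (certificate p q) atTop (𝓝 (9 / 8)) := by
  have h := ((tendsto_div_of_eq (f := fun k => (k : ℝ)) (g := fun k => 2 * k + 3 * p + 3 * q + 5)
      1 0 2 (3 * p + 3 * q + 5) (l := 1 / 2) (by norm_num) (by intros; ring) (by intros; ring)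
      (by norm_num)).const_mul 9).mul
    (tendsto_div_of_eq (f := fun k => 2 * k + 4 * p + 2 * q + 5) (g := fun k => 8 * k + 6 * p + 5)
      2 (4 * p + 2 * q + 5) 8 (6 * p + 5) (l := 1 / 4) (by norm_num) (by intros; ring)
      (by intros; ring) (by norm_num))
  norm_num at h
  exact h

section sums

variable {p q : ℤ}

theorem summable_term (h₁ : 0 ≤ p + q + 1) (h₂ : 0 ≤ p - q) : Summable (term p q) := by
  refine summable_of_ratio_test_tendsto_lt_one (l := |1 / 9|) (by norm_num [abs_lt])
    (Eventually.of_forall (term_ne_zero h₁ h₂)) ((tendsto_termRatio p q).abs.congr fun k => ?_)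
  rw [term_succ h₁ h₂, norm_mul, mul_div_cancel_left₀ _ (norm_ne_zero_iff.2 (term_ne_zero h₁ h₂ k)),
    Real.norm_eq_abs]

theorem tsum_term_add_one (h₁ : 0 ≤ p + q + 1) (h₂ : 0 ≤ p - q) :
    ∑' k, term (p + 1) q k = ∑' k, term p q k := by
  have s₁ := summable_term h₁ h₂
  have s₂ : Summable (term (p + 1) q) := summable_term (by omega) (by omega)
  have hG : Tendsto (fun k => certificate p q k * term p q k) atTop (𝓝 0) := by
    simpa using (tendsto_certificate p q).mul s₁.tendsto_atTop_zero
  have h := (s₂.sub s₁).hasSum.tendsto_sum_nat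
  have h' : Tendsto (fun n => ∑ k ∈ Finset.range n, (term (p + 1) q k - term p q k))
      atTop (𝓝 0) := by
    refine hG.congr fun n => ?_
    simp_rw [term_add_one_sub h₁ h₂]
    rw [Finset.sum_range_sub (fun k => certificate p q k * term p q k)]
    simp [certificate]
  have := tendsto_nhds_unique h h'
  rw [s₂.tsum_sub s₁] at this
  linarith

theorem tsum_term_add_nat (h₁ : 0 ≤ p + q + 1) (h₂ : 0 ≤ p - q) (n : ℕ) :
    ∑' k, term (p + n) q k = ∑' k, term p q k := by
  induction n with
  | zero => simp
  | succ n ih =>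
    rw [← ih, ← tsum_term_add_one (p := p + n) (by omega) (by omega)]
    push_cast
    rw [add_assoc]

end sums

theorem tendsto_halfGamma_div (m : ℤ) :
    Tendsto (fun n : ℕ => halfGamma (m + n + 1) / (n.factorial * (n : ℝ) ^ ((m : ℝ) + 1 / 2)))
      atTop (𝓝 1) := by
  have hm := halfGamma_ne_zero m
  have h : Tendsto (fun n => halfGamma m / Real.GammaSeq (m + 1 / 2) n) atTop
      (𝓝 (halfGamma m / halfGamma m)) :=
    tendsto_const_nhds.div (Real.GammaSeq_tendsto_Gamma _) hm
  rw [div_self hm] at h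
  refine h.congr fun n => ?_
  have hp : halfGamma (m + n + 1) =
      (∏ j ∈ Finset.range (n + 1), ((m : ℝ) + 1 / 2 + j)) * halfGamma m := by
    induction n with
    | zero => simp [halfGamma_add_one]
    | succ n ih =>
      rw [Finset.prod_range_succ, show m + ((n + 1 : ℕ) : ℤ) + 1 = m + n + 1 + 1 by push_cast; ring,
        halfGamma_add_one, ih]
      push_cast
      ring
  rw [hp, Real.GammaSeq, div_div_eq_mul_div, mul_comm (halfGamma m), mul_comm (n.factorial : ℝ)]

theorem tendsto_term_zero (q : ℤ) :
    Tendsto (fun n : ℕ => term (q + n) q 0) atTop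
      (𝓝 (Real.pi * (-1) ^ q * (6 * (3 : ℝ) ^ (-(3 * (q : ℝ) + 5 / 2))))) := by
  have hM : Tendsto (fun n : ℕ => (6 * q + 3 * n + 4).toNat) atTop atTop := by
    refine tendsto_atTop.2 fun b => ?_
    filter_upwards [eventually_ge_atTop (b + (6 * q).natAbs)] with n hn
    omega
  have t₁ := tendsto_halfGamma_div (3 * q + 1)
  have t₂ := (tendsto_halfGamma_div (-3 * q - 3)).comp hM
  have t₃ : Tendsto (fun n : ℕ => ((3 * (n : ℝ) + (6 * q + 4)) / (1 * n + 0)) ^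
      (-(3 * (q : ℝ) + 5 / 2))) atTop (𝓝 ((3 / 1 : ℝ) ^ (-(3 * (q : ℝ) + 5 / 2)))) :=
    (tendsto_linear_div_linear 3 _ 1 0 one_ne_zero).rpow_const (Or.inl (by norm_num))
  have t₄ := tendsto_linear_div_linear 6 (6 * q + 5) 1 0 one_ne_zero
  have t := ((t₁.mul t₂).mul (t₄.mul t₃)).const_mul (Real.pi * (-1) ^ q)
  simp only [div_one, one_mul] at t
  refine t.congr' ?_
  filter_upwards [eventually_gt_atTop ((6 * q).natAbs)] with n hn
  have hn0 : (0 : ℝ) < n := by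
    have : 0 < n := by omega
    exact_mod_cast this
  have hMpos : 0 < 6 * q + 3 * n + 4 := by omega
  have hMc : (((6 * q + 3 * n + 4).toNat : ℤ)) = 6 * q + 3 * n + 4 := Int.toNat_of_nonneg hMpos.le
  have hMr : (((6 * q + 3 * n + 4).toNat : ℝ)) = 3 * n + (6 * q + 4) := by
    have : ((((6 * q + 3 * n + 4).toNat : ℤ)) : ℝ) = ((6 * q + 3 * n + 4 : ℤ) : ℝ) := by rw [hMc]
    push_cast at this
    linarith
  have hX : (0 : ℝ) < 3 * n + (6 * q + 4) := by
    rw [← hMr]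
    have : 0 < (6 * q + 3 * n + 4).toNat := by omega
    exact_mod_cast this
  have hpow : (n : ℝ) ^ (-(3 * (q : ℝ) + 5 / 2)) =
      ((n : ℝ) ^ (((3 * q + 1 : ℤ) : ℝ) + 1 / 2))⁻¹ * (n : ℝ)⁻¹ := by
    rw [← Real.rpow_neg hn0.le, ← Real.rpow_neg_one, ← Real.rpow_add hn0]
    congr 1
    push_cast
    ring
  have hexp : (((-3 * q - 3 : ℤ) : ℝ) + 1 / 2) = -(3 * (q : ℝ) + 5 / 2) := by
    push_cast
    ring
  have hsign : (-1 : ℝ) ^ (3 * q + 2) = (-1) ^ q := by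
    rw [show 3 * q + 2 = q + 2 * (q + 1) by ring, zpow_add₀ (by norm_num), zpow_mul]
    norm_num
  have hrefl := halfGamma_mul_neg (3 * q + 2)
  rw [hsign] at hrefl
  have hfn : intFactorial (((0 : ℕ) : ℤ) + (q + n) - q) = n.factorial := by
    rw [show ((0 : ℕ) : ℤ) + (q + n) - q = n by push_cast; ring, intFactorial, Int.toNat_natCast]
  have hfM : intFactorial (2 * ((0 : ℕ) : ℤ) + 3 * (q + n) + 3 * q + 4) =
      ((6 * q + 3 * n + 4).toNat.factorial : ℝ) := by
    rw [show 2 * ((0 : ℕ) : ℤ) + 3 * (q + n) + 3 * q + 4 = 6 * q + 3 * n + 4 by push_cast; ring,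
      intFactorial]
  have hf0 : intFactorial ((0 : ℕ) : ℤ) = 1 := by simp [intFactorial]
  simp only [Function.comp_apply]
  unfold term
  rw [hfn, hfM, hf0, hexp, hMr, hMc, one_mul, add_zero, Real.div_rpow hX.le hn0.le, hpow, ← hrefl,
    show q + n + 2 * q + 2 = 3 * q + 1 + n + 1 by ring,
    show ((0 : ℕ) : ℤ) + 3 * (q + n) + 2 = -3 * q - 3 + (6 * q + 3 * n + 4) + 1 by
      push_cast; ring,
    show ((0 : ℕ) : ℤ) + 3 * q + 2 = 3 * q + 2 by push_cast; ring,
    show 2 * ((0 : ℕ) : ℤ) - 3 * q - 2 = -(3 * q + 2) by push_cast; ring]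
  have hY := (Real.rpow_pos_of_pos hX (-(3 * (q : ℝ) + 5 / 2))).ne'
  have hZ := (Real.rpow_pos_of_pos hn0 (((3 * q + 1 : ℤ) : ℝ) + 1 / 2)).ne'
  have hM0 : ((6 * q + 3 * n + 4).toNat.factorial : ℝ) ≠ 0 := by positivity
  have hn0' : (n.factorial : ℝ) ≠ 0 := by positivity
  generalize (3 * (n : ℝ) + (6 * q + 4)) ^ (-(3 * (q : ℝ) + 5 / 2)) = Y at *
  generalize (n : ℝ) ^ (((3 * q + 1 : ℤ) : ℝ) + 1 / 2) = Z at *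
  push_cast
  field_simp
  ring

theorem tendsto_termRatio_atTop (q : ℤ) (k : ℕ) :
    Tendsto (fun n : ℕ => termRatio (q + n) q k) atTop (𝓝 0) := by
  have h := (((((tendsto_div_of_eq (f := fun n => k + 3 * (q + n : ℤ) + 5 / 2)
      (g := fun n => k + (q + n : ℤ) - q + 1) 3 (k + 3 * q + 5 / 2) 1 (k + 1) (l := 3)
      (by norm_num) (by intros; push_cast; ring) (by intros; push_cast; ring)
      (by norm_num)).mul_const (((k : ℝ) + 3 * q + 5 / 2) / (k + 1))).mul
    (tendsto_div_of_eq (f := fun _ => 2 * (k : ℝ) - 3 * q - 3 / 2)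
      (g := fun n => 2 * k + 3 * (q + n : ℤ) + 3 * q + 5) 0 (2 * k - 3 * q - 3 / 2) 3
      (2 * k + 6 * q + 5) (l := 0) (by norm_num) (by intros; ring)
      (by intros; push_cast; ring) (by norm_num))).mul
    (tendsto_div_of_eq (f := fun _ => 2 * (k : ℝ) - 3 * q - 1 / 2)
      (g := fun n => 2 * k + 3 * (q + n : ℤ) + 3 * q + 6) 0 (2 * k - 3 * q - 1 / 2) 3
      (2 * k + 6 * q + 6) (l := 0) (by norm_num) (by intros; ring)
      (by intros; push_cast; ring) (by norm_num))).mul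
    (tendsto_div_of_eq (f := fun n => 8 * k + 6 * (q + n : ℤ) + 13)
      (g := fun n => 8 * k + 6 * (q + n : ℤ) + 5) 6 (8 * k + 6 * q + 13) 6 (8 * k + 6 * q + 5)
      (l := 1) (by norm_num) (by intros; push_cast; ring) (by intros; push_cast; ring)
      (by norm_num))).div_const 9
  simpa [termRatio] using h

theorem tendsto_term_succ (q : ℤ) (k : ℕ) :
    Tendsto (fun n : ℕ => term (q + n) q (k + 1)) atTop (𝓝 0) := by
  have key : ∀ (k : ℕ) (L : ℝ), Tendsto (fun n : ℕ => term (q + n) q k) atTop (𝓝 L) →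
      Tendsto (fun n : ℕ => term (q + n) q (k + 1)) atTop (𝓝 0) := by
    intro k L hL
    have h := hL.mul (tendsto_termRatio_atTop q k)
    rw [mul_zero] at h
    refine h.congr' ?_
    filter_upwards [eventually_ge_atTop (2 * q + 1).natAbs] with n hn
    rw [term_succ (by omega) (by omega)]
  induction k with
  | zero => exact key _ _ (tendsto_term_zero q)
  | succ k ih => exact key _ _ ih

/-- A bound for the quotient of consecutive summands that is uniform in large `p`. -/
noncomputable def ratioBound (q : ℤ) (k : ℕ) : ℝ :=
  2 / 3 * |((k : ℝ) + 3 * q + 5 / 2) / (k + 1)|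

theorem ratioBound_pos (q : ℤ) (k : ℕ) : 0 < ratioBound q k := by
  have h := half_int_ne_zero (k + 3 * q + 2)
  have h' : (k : ℝ) + 3 * q + 5 / 2 ≠ 0 := by
    push_cast at h
    intro e
    apply h
    linarith
  unfold ratioBound
  positivity

theorem abs_termRatio_le {p q : ℤ} (h₁ : 4 * |q| ≤ p) (h₂ : 2 ≤ p) (k : ℕ) :
    |termRatio p q k| ≤ ratioBound q k := by
  have c₁ : 4 * |(q : ℝ)| ≤ p := by exact_mod_cast h₁
  have c₂ : (2 : ℝ) ≤ p := by exact_mod_cast h₂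
  have hk : (0 : ℝ) ≤ k := k.cast_nonneg
  have hq := neg_abs_le (q : ℝ)
  have hq' := le_abs_self (q : ℝ)
  have b₁ : |((k : ℝ) + 3 * p + 5 / 2) / (k + p - q + 1)| ≤ 4 := by
    rw [abs_of_nonneg (div_nonneg (by linarith) (by linarith)), div_le_iff₀ (by linarith)]
    linarith
  have b₂ : |(2 * (k : ℝ) - 3 * q - 3 / 2) / (2 * k + 3 * p + 3 * q + 5)| ≤ 1 := by
    have hd : (0 : ℝ) < 2 * k + 3 * p + 3 * q + 5 := by linarith
    rw [abs_div, abs_of_pos hd, div_le_one hd, abs_le]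
    constructor <;> linarith
  have b₃ : |(2 * (k : ℝ) - 3 * q - 1 / 2) / (2 * k + 3 * p + 3 * q + 6)| ≤ 1 := by
    have hd : (0 : ℝ) < 2 * k + 3 * p + 3 * q + 6 := by linarith
    rw [abs_div, abs_of_pos hd, div_le_one hd, abs_le]
    constructor <;> linarith
  have b₄ : |(8 * (k : ℝ) + 6 * p + 13) / (8 * k + 6 * p + 5)| ≤ 3 / 2 := by
    rw [abs_of_nonneg (div_nonneg (by linarith) (by linarith)), div_le_iff₀ (by linarith)]
    linarith
  unfold termRatio ratioBound
  rw [abs_div, abs_mul, abs_mul, abs_mul, abs_mul, abs_of_pos (by norm_num : (0 : ℝ) < 9),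
    div_le_iff₀ (by norm_num)]
  calc _ ≤ 4 * |((k : ℝ) + 3 * q + 5 / 2) / (k + 1)| * 1 * 1 * (3 / 2) := by gcongr
    _ = _ := by ring

theorem summable_prod_ratioBound (q : ℤ) :
    Summable fun k => ∏ j ∈ Finset.range k, ratioBound q j := by
  have hpos : ∀ k, 0 < ∏ j ∈ Finset.range k, ratioBound q j := fun k =>
    Finset.prod_pos fun j _ => ratioBound_pos q j
  have h := ((tendsto_div_of_eq (f := fun k => (k : ℝ) + 3 * q + 5 / 2) (g := fun k => k + 1)
      1 (3 * q + 5 / 2) 1 1 (l := 1) (by norm_num) (by intros; ring) (by intros; ring)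
      (by norm_num)).abs).const_mul (2 / 3)
  refine summable_of_ratio_test_tendsto_lt_one (l := 2 / 3 * |1|) (by norm_num)
    (Eventually.of_forall fun k => (hpos k).ne') (h.congr fun k => ?_)
  rw [Finset.prod_range_succ, norm_mul, mul_div_cancel_left₀ _ (norm_ne_zero_iff.2 (hpos k).ne'),
    Real.norm_of_nonneg (ratioBound_pos q k).le, ratioBound]

theorem abs_term_le {p q : ℤ} (h₁ : 4 * |q| ≤ p) (h₂ : 2 ≤ p) (k : ℕ) :
    |term p q k| ≤ |term p q 0| * ∏ j ∈ Finset.range k, ratioBound q j := by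
  have hq := neg_abs_le q
  have hq' := le_abs_self q
  induction k with
  | zero => simp
  | succ k ih =>
    rw [term_succ (by omega) (by omega), abs_mul, Finset.prod_range_succ, ← mul_assoc]
    exact mul_le_mul ih (abs_termRatio_le h₁ h₂ k) (abs_nonneg _) ((abs_nonneg _).trans ih)

theorem tendsto_tsum_term (q : ℤ) :
    Tendsto (fun n : ℕ => ∑' k, term (q + n) q k) atTop
      (𝓝 (Real.pi * (-1) ^ q * (6 * (3 : ℝ) ^ (-(3 * (q : ℝ) + 5 / 2))))) := by
  have h0 := tendsto_term_zero q
  set L : ℝ := Real.pi * (-1) ^ q * (6 * (3 : ℝ) ^ (-(3 * (q : ℝ) + 5 / 2))) with hL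
  rw [← tsum_ite_eq (0 : ℕ) (fun _ => L)]
  refine tendsto_tsum_of_dominated_convergence
    (bound := fun k => (|L| + 1) * ∏ j ∈ Finset.range k, ratioBound q j)
    ((summable_prod_ratioBound q).mul_left _) (fun k => ?_) ?_
  · cases k with
    | zero => simpa using h0
    | succ k => simpa using tendsto_term_succ q k
  · filter_upwards [h0.abs.eventually_le_const (lt_add_one |L|),
      eventually_ge_atTop (5 * q.natAbs + 2)] with n hn hn' k
    have habs := Int.abs_eq_natAbs q
    refine (abs_term_le (by omega) (by omega) k).trans ?_
    gcongr
    exact Finset.prod_nonneg fun j _ => (ratioBound_pos q j).le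

theorem tsum_term {p q : ℤ} (h₁ : 0 ≤ p + q + 1) (h₂ : 0 ≤ p - q) :
    ∑' k, term p q k = Real.pi * (-1) ^ q * (6 * (3 : ℝ) ^ (-(3 * (q : ℝ) + 5 / 2))) := by
  refine tendsto_nhds_unique (tendsto_const_nhds.congr' ?_) (tendsto_tsum_term q)
  filter_upwards [eventually_ge_atTop (p - q).toNat] with n hn
  rw [← tsum_term_add_nat h₁ h₂ (n - (p - q).toNat)]
  congr! 3
  omega

theorem halfGamma_constants :
    halfGamma 0 * (halfGamma 2 * halfGamma 2 * halfGamma (-2)) = 3 / 4 * Real.pi ^ 2 := by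
  have h₀ := halfGamma_mul_neg 0
  have h₂ := halfGamma_mul_neg 2
  have e₁ := halfGamma_add_one 0
  have e₂ := halfGamma_add_one 1
  norm_num at h₀ h₂ e₁ e₂
  rw [mul_assoc, h₂, e₂, e₁]
  linear_combination (3 / 4 * Real.pi) * h₀

end WeiGong

open WeiGong in
theorem wei_gong_thm7 (p q : ℤ)
    (h : 0 ≤ min (p + q + 1) (p - q)) :
    8 * (-1 : ℝ) ^ q / ((3 : ℝ) ^ ((3*(q : ℝ)) + 5/2) * Real.pi) =
      shiftedFactorial (1/2) (p + 2*q + 2) *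
      ∑' k : ℕ,
        (shiftedFactorial (5/2) ((k : ℤ) + 3*p) * shiftedFactorial (5/2) ((k : ℤ) + 3*q) *
          shiftedFactorial (-(3/2)) (2*(k : ℤ) - 3*q)) /
        ((k.factorial : ℝ) * (((k : ℤ) + p - q).toNat.factorial : ℝ) *
          ((2*(k : ℤ) + 3*p + 3*q + 4).toNat.factorial : ℝ)) *
        ((8*(k : ℝ) + 6*(p : ℝ) + 5) / (9 : ℝ) ^ k) := by
  obtain ⟨h₁, h₂⟩ := le_min_iff.1 h
  have s₁ := shiftedFactorial_half 0
  have s₂ := shiftedFactorial_half 2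
  have s₃ := shiftedFactorial_half (-2)
  norm_num at s₁ s₂ s₃
  have hc := halfGamma_constants
  have hterm : ∀ k : ℕ, shiftedFactorial (1/2) (p + 2*q + 2) *
        ((shiftedFactorial (5/2) ((k : ℤ) + 3*p) * shiftedFactorial (5/2) ((k : ℤ) + 3*q) *
          shiftedFactorial (-(3/2)) (2*(k : ℤ) - 3*q)) /
        ((k.factorial : ℝ) * (((k : ℤ) + p - q).toNat.factorial : ℝ) *
          ((2*(k : ℤ) + 3*p + 3*q + 4).toNat.factorial : ℝ)) *
        ((8*(k : ℝ) + 6*(p : ℝ) + 5) / (9 : ℝ) ^ k)) =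
      (3 / 4 * Real.pi ^ 2)⁻¹ * term p q k := by
    intro k
    rw [← hc, s₁, s₂, s₂, s₃]
    simp only [term, intFactorial, Int.toNat_natCast, ← sub_eq_add_neg]
    field_simp
  rw [← tsum_mul_left]
  simp_rw [hterm]
  rw [tsum_mul_left, tsum_term h₁ h₂, Real.rpow_neg (by norm_num)]
  have hp := Real.pi_ne_zero
  field_simp
  norm_num
end
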